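/- arXiv:math/0605453 — 3 statements merged into one kernel-verified Lean document; each statement's English description precedes it below -/
import Mathlib

section
/- (Hartman's theorem, equation (1.3).) Fix 0 < a < A < ∞. Then there exist c ≥ 0 and a Borel measure μ on (0,∞) with ∫₀^∞ min(1,r) μ(dr) < ∞ such that for every γ ≥ 0: ( I_{√(2γ)}(a)·I_0(A) ) / ( I_{√(2γ)}(A)·I_0(a) ) = exp( −( c·γ + ∫₀^∞ (1 − e^{−γ·r}) μ(dr) ) ). In other words, γ ↦ I_{√(2γ)}(a)I_0(A)/(I_{√(2γ)}(A)I_0(a)) is the Laplace transform of an infinitely divisible probability distribution on [0,∞). -/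
open MeasureTheory Real Set Filter Topology

/-- The modified Bessel function of the first kind of index `v`:
`I_v(x) = Σ_{n≥0} (x/2)^{v+2n} / (n! Γ(v+n+1))`. -/
noncomputable def besselI (v x : ℝ) : ℝ :=
  ∑' n : ℕ, (x / 2) ^ (v + 2 * (n : ℝ)) / ((n.factorial : ℝ) * Real.Gamma (v + n + 1))


/-- The kernel `(1 - w ^ γ) / (1 - w)`, extended by its limit `γ` at `w = 1`. -/
noncomputable def bernsteinKernel (γ w : ℝ) : ℝ := dslope (fun x : ℝ => x ^ γ) 1 w

lemma bernsteinKernel_mul (γ w : ℝ) : (1 - w) * bernsteinKernel γ w = 1 - w ^ γ := by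
  have h := sub_smul_dslope (fun x : ℝ => x ^ γ) 1 w
  simp only [smul_eq_mul, Real.one_rpow] at h
  rw [bernsteinKernel]
  linarith

lemma bernsteinKernel_of_ne (γ : ℝ) {w : ℝ} (hw : w ≠ 1) :
    bernsteinKernel γ w = (1 - w ^ γ) / (1 - w) := by
  rw [eq_div_iff (sub_ne_zero.2 hw.symm), mul_comm, bernsteinKernel_mul]

lemma bernsteinKernel_one_right (γ : ℝ) : bernsteinKernel γ 1 = γ := by
  simp [bernsteinKernel, dslope_same]

lemma bernsteinKernel_zero_right {γ : ℝ} (hγ : 0 < γ) : bernsteinKernel γ 0 = 1 := by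
  rw [bernsteinKernel_of_ne γ zero_ne_one, Real.zero_rpow hγ.ne']
  norm_num

lemma bernsteinKernel_one_left (w : ℝ) : bernsteinKernel 1 w = 1 := by
  by_cases hw : w = 1
  · rw [hw, bernsteinKernel_one_right]
  · rw [bernsteinKernel_of_ne 1 hw, Real.rpow_one, div_self (sub_ne_zero.2 (Ne.symm hw))]

lemma continuous_bernsteinKernel {γ : ℝ} (hγ : 0 < γ) : Continuous (bernsteinKernel γ) := by
  rw [continuous_iff_continuousAt]
  intro w
  by_cases hw : w = 1
  · subst hw
    exact continuousAt_dslope_same.2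
      (Real.differentiableAt_rpow_const_of_ne γ one_ne_zero)
  · exact (continuousAt_dslope_of_ne hw).2 (Real.continuousAt_rpow_const w γ (Or.inr hγ.le))

lemma bernsteinKernel_nonneg {γ w : ℝ} (hγ : 0 < γ) (hw0 : 0 ≤ w) (hw1 : w ≤ 1) :
    0 ≤ bernsteinKernel γ w := by
  rcases hw1.eq_or_lt with rfl | h
  · rw [bernsteinKernel_one_right]; exact hγ.le
  · rw [bernsteinKernel_of_ne γ h.ne]
    exact div_nonneg (sub_nonneg.2 (Real.rpow_le_one hw0 hw1 hγ.le)) (sub_nonneg.2 hw1)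

lemma bernsteinKernel_le_one {γ w : ℝ} (hγ : 0 < γ) (hγ1 : γ ≤ 1) (hw0 : 0 ≤ w) (hw1 : w ≤ 1) :
    bernsteinKernel γ w ≤ 1 := by
  rcases hw1.eq_or_lt with rfl | h
  · rwa [bernsteinKernel_one_right]
  · rw [bernsteinKernel_of_ne γ h.ne, div_le_one (sub_pos.2 h)]
    rcases hw0.eq_or_lt with rfl | h0
    · rw [Real.zero_rpow hγ.ne']
    · have := Real.rpow_le_rpow_of_exponent_ge h0 hw1 hγ1
      rw [Real.rpow_one] at this
      linarith

/-- `f` is a Bernstein function on `(0, ∞)`, represented by a finite measure on `[0, 1]`: the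
atom at `0` is the killing term, the atom at `1` the drift, and the rest the Lévy measure, in the
variable `w = exp (-r)` and with density `1 - w`. -/
def IsBernsteinFun (f : ℝ → ℝ) : Prop :=
  ∃ σ : FiniteMeasure unitInterval, ∀ γ : ℝ, 0 < γ →
    f γ = ∫ w, bernsteinKernel γ w ∂(σ : Measure unitInterval)

lemma integrable_bernsteinKernel {γ : ℝ} (hγ : 0 < γ) (σ : Measure unitInterval)
    [IsFiniteMeasure σ] : Integrable (fun w : unitInterval => bernsteinKernel γ w) σ :=
  ((continuous_bernsteinKernel hγ).comp continuous_subtype_val).integrable_of_hasCompactSupport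
    (HasCompactSupport.of_compactSpace _)

namespace IsBernsteinFun

lemma congr {f g : ℝ → ℝ} (hf : IsBernsteinFun f) (h : ∀ γ, 0 < γ → g γ = f γ) :
    IsBernsteinFun g := by
  obtain ⟨σ, hσ⟩ := hf
  exact ⟨σ, fun γ hγ => (h γ hγ).trans (hσ γ hγ)⟩

lemma add {f g : ℝ → ℝ} (hf : IsBernsteinFun f) (hg : IsBernsteinFun g) :
    IsBernsteinFun (fun γ => f γ + g γ) := by
  obtain ⟨σ, hσ⟩ := hf
  obtain ⟨τ, hτ⟩ := hg
  refine ⟨σ + τ, fun γ hγ => ?_⟩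
  beta_reduce
  rw [FiniteMeasure.toMeasure_add, integral_add_measure (integrable_bernsteinKernel hγ _)
    (integrable_bernsteinKernel hγ _), hσ γ hγ, hτ γ hγ]

lemma atom {c : ℝ} (hc : 0 ≤ c) (w : unitInterval) :
    IsBernsteinFun (fun γ => c * (1 - (w : ℝ) ^ γ)) := by
  have hw : 0 ≤ c * (1 - (w : ℝ)) := mul_nonneg hc (sub_nonneg.2 w.2.2)
  refine ⟨⟨ENNReal.ofReal (c * (1 - w)) • Measure.dirac w,
    Measure.smul_finite _ ENNReal.ofReal_ne_top⟩, fun γ hγ => ?_⟩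
  rw [FiniteMeasure.toMeasure_mk, integral_smul_measure, integral_dirac,
    ENNReal.toReal_ofReal hw, smul_eq_mul, mul_assoc, bernsteinKernel_mul]

lemma const {c : ℝ} (hc : 0 ≤ c) : IsBernsteinFun (fun _ => c) :=
  (atom hc 0).congr fun γ hγ => by simp [Real.zero_rpow hγ.ne']

lemma sum {ι : Type*} (s : Finset ι) {f : ι → ℝ → ℝ} (hf : ∀ i ∈ s, IsBernsteinFun (f i)) :
    IsBernsteinFun (fun γ => ∑ i ∈ s, f i γ) := by
  classical
  induction s using Finset.induction_on with
  | empty => simpa using const le_rfl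
  | insert i s hi ih =>
    simp only [Finset.sum_insert hi]
    exact (hf i (Finset.mem_insert_self i s)).add
      (ih fun j hj => hf j (Finset.mem_insert_of_mem hj))

lemma one_sub_eval {p : Polynomial ℝ} (hp : ∀ i, 0 ≤ p.coeff i) (hp1 : p.eval 1 ≤ 1) {s : ℝ}
    (hs : 0 ≤ s) : IsBernsteinFun (fun γ => 1 - p.eval (Real.exp (-(γ * s)))) := by
  refine ((const (sub_nonneg.2 hp1)).add (sum (Finset.range (p.natDegree + 1))
    (f := fun i γ => p.coeff i * (1 - Real.exp (-(s * i)) ^ γ))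
    fun i _ => atom (hp i) ⟨Real.exp (-(s * i)), (Real.exp_pos _).le, ?_⟩)).congr fun γ _ => ?_
  · rw [Real.exp_le_one_iff]
    have : (0 : ℝ) ≤ s * i := by positivity
    linarith
  · rw [Polynomial.eval_eq_sum_range, Polynomial.eval_eq_sum_range]
    simp only [one_pow, mul_one, mul_sub, Finset.sum_sub_distrib]
    have : ∀ i : ℕ, Real.exp (-(γ * s)) ^ i = Real.exp (-(s * i)) ^ γ := fun i => by
      rw [← Real.exp_nat_mul, ← Real.exp_mul]
      congr 1
      ring
    simp only [this]
    ring

lemma of_tendsto {f : ℕ → ℝ → ℝ} {g : ℝ → ℝ} (hf : ∀ n, IsBernsteinFun (f n))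
    (hg : ∀ γ, 0 < γ → Tendsto (fun n => f n γ) atTop (𝓝 (g γ))) : IsBernsteinFun g := by
  choose σ hσ using hf
  have hmass : ∀ n, ((σ n).mass : ℝ) = f n 1 := fun n => by
    rw [hσ n 1 one_pos]
    simp only [bernsteinKernel_one_left, integral_const, smul_eq_mul, mul_one]
    rfl
  obtain ⟨C, hC⟩ := (hg 1 one_pos).bddAbove_range
  have hmem : ∀ n, σ n ∈ {μ : FiniteMeasure unitInterval | μ.mass ≤ C.toNNReal} := fun n =>
    NNReal.le_toNNReal_of_coe_le ((hmass n).le.trans (hC ⟨n, rfl⟩))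
  obtain ⟨τ, -, hτ⟩ := (isCompact_setOfPred_finiteMeasure_le_of_compactSpace unitInterval
    C.toNNReal).exists_mapClusterPt (f := (atTop : Filter ℕ)) (u := σ)
    (tendsto_principal.2 (Eventually.of_forall hmem))
  refine ⟨τ, fun γ hγ => ?_⟩
  have hcont : Continuous (fun μ : FiniteMeasure unitInterval =>
      ∫ w, bernsteinKernel γ w ∂(μ : Measure unitInterval)) :=
    FiniteMeasure.continuous_integral_boundedContinuousFunction
      (BoundedContinuousFunction.mkOfCompact
        ⟨fun w : unitInterval => bernsteinKernel γ w,
          (continuous_bernsteinKernel hγ).comp continuous_subtype_val⟩)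
  have h := hτ.continuousAt_comp hcont.continuousAt
  have h2 : Tendsto ((fun μ : FiniteMeasure unitInterval =>
      ∫ w, bernsteinKernel γ w ∂(μ : Measure unitInterval)) ∘ σ) atTop (𝓝 (g γ)) :=
    (hg γ hγ).congr fun n => hσ n γ hγ
  have : (𝓝 (∫ w, bernsteinKernel γ w ∂(τ : Measure unitInterval)) ⊓ 𝓝 (g γ)).NeBot :=
    h.clusterPt.mono h2
  exact (eq_of_nhds_neBot this).symm

end IsBernsteinFun

lemma tendsto_integral_bernsteinKernel_zero (σ : Measure unitInterval) [IsFiniteMeasure σ] :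
    Tendsto (fun γ => ∫ w : unitInterval, bernsteinKernel γ w ∂σ) (𝓝[>] 0)
      (𝓝 (σ.real {0})) := by
  have h0 : ∫ w, ({0} : Set unitInterval).indicator (fun _ => (1 : ℝ)) w ∂σ = σ.real {0} := by
    rw [integral_indicator_const _ (measurableSet_singleton 0), smul_eq_mul, mul_one]
  rw [← h0]
  have hpos : ∀ᶠ γ : ℝ in 𝓝[>] 0, 0 < γ := eventually_mem_nhdsWithin
  refine tendsto_integral_filter_of_dominated_convergence (fun _ => 1) ?_ ?_
    (integrable_const _) (Eventually.of_forall fun w => ?_)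
  · filter_upwards [hpos] with γ hγ using (integrable_bernsteinKernel hγ σ).1
  · have hle : ∀ᶠ γ : ℝ in 𝓝[>] 0, γ ≤ 1 :=
      nhdsWithin_le_nhds (eventually_le_nhds zero_lt_one)
    filter_upwards [hpos, hle] with γ hγ hγ1
    refine Eventually.of_forall fun w => ?_
    rw [Real.norm_of_nonneg (bernsteinKernel_nonneg hγ w.2.1 w.2.2)]
    exact bernsteinKernel_le_one hγ hγ1 w.2.1 w.2.2
  · by_cases hw0 : w = 0
    · subst hw0
      refine tendsto_const_nhds.congr' ?_
      filter_upwards [hpos] with γ hγ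
      simp [bernsteinKernel_zero_right hγ]
    · have hw0' : (w : ℝ) ≠ 0 := fun h => hw0 (Subtype.ext h)
      rw [indicator_of_notMem (by simpa using hw0)]
      by_cases hw1 : (w : ℝ) = 1
      · simp only [hw1, bernsteinKernel_one_right]
        exact tendsto_nhdsWithin_of_tendsto_nhds tendsto_id
      · simp only [bernsteinKernel_of_ne _ hw1]
        have h : Tendsto (fun γ : ℝ => (1 - (w : ℝ) ^ γ) / (1 - w)) (𝓝 0)
            (𝓝 ((1 - (w : ℝ) ^ (0 : ℝ)) / (1 - w))) :=
          ((Real.continuousAt_const_rpow hw0').const_sub 1).div_const _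
        rw [Real.rpow_zero, sub_self, zero_div] at h
        exact tendsto_nhdsWithin_of_tendsto_nhds h

lemma min_one_le_two_mul_one_sub_exp_neg {r : ℝ} (hr : 0 ≤ r) :
    min 1 r ≤ 2 * (1 - Real.exp (-r)) := by
  have h1 : Real.exp (-r) ≤ 1 / (1 + r) := by
    rw [Real.exp_neg, ← one_div]
    exact one_div_le_one_div_of_le (by linarith) (by linarith [Real.add_one_le_exp r])
  have h2 : min 1 r ≤ 2 * (1 - 1 / (1 + r)) := by
    have h3 : 2 * (1 - 1 / (1 + r)) = 2 * r / (1 + r) := by field_simp; ring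
    rw [h3, le_div_iff₀ (by linarith)]
    rcases le_total 1 r with h | h
    · rw [min_eq_left h]; linarith
    · rw [min_eq_right h]; nlinarith
  linarith

/-- The Lévy–Khintchine representation of a Bernstein function. -/
lemma IsBernsteinFun.exists_levy {f : ℝ → ℝ} (hf : IsBernsteinFun f) {f₀ : ℝ}
    (hf₀ : Tendsto f (𝓝[>] 0) (𝓝 f₀)) :
    ∃ c : ℝ, 0 ≤ c ∧ ∃ μ : Measure ℝ,
      (∫⁻ r in Ioi (0 : ℝ), ENNReal.ofReal (min 1 r) ∂μ < ⊤) ∧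
      ∀ γ : ℝ, 0 < γ →
        f γ - f₀ = c * γ + ∫ r in Ioi (0 : ℝ), (1 - Real.exp (-γ * r)) ∂μ := by
  obtain ⟨σ', hσ⟩ := hf
  set σ : Measure unitInterval := (σ' : Measure unitInterval)
  have hf₀' : f₀ = σ.real {0} := by
    refine tendsto_nhds_unique hf₀ ((tendsto_integral_bernsteinKernel_zero σ).congr' ?_)
    filter_upwards [eventually_mem_nhdsWithin] with γ hγ using (hσ γ hγ).symm
  set S : Set unitInterval := {w | w ≠ 0 ∧ w ≠ 1}
  have hS : MeasurableSet S :=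
    (measurableSet_singleton (0 : unitInterval)).compl.inter
      (measurableSet_singleton (1 : unitInterval)).compl
  let g : unitInterval → ℝ := fun w => -Real.log w
  have hg : Measurable g := (Real.measurable_log.comp measurable_subtype_coe).neg
  have hS_lt : ∀ w ∈ S, 0 < (w : ℝ) ∧ (w : ℝ) < 1 := fun w hw =>
    ⟨lt_of_le_of_ne w.2.1 fun h => hw.1 (Subtype.ext h.symm),
      lt_of_le_of_ne w.2.2 fun h => hw.2 (Subtype.ext h)⟩
  have hpre : g ⁻¹' Ioi 0 = S := by
    ext w
    simp only [g, mem_preimage, mem_Ioi, S]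
    constructor
    · intro h
      refine ⟨?_, ?_⟩ <;> rintro rfl <;> simp at h
    · intro h
      have := Real.log_neg (hS_lt w h).1 (hS_lt w h).2
      linarith
  have hexp : ∀ w ∈ S, Real.exp (-g w) = w := fun w hw => by
    simp only [g, neg_neg]
    exact Real.exp_log (hS_lt w hw).1
  let d : unitInterval → ENNReal := fun w => ENNReal.ofReal (1 / (1 - (w : ℝ)))
  have hd : Measurable d :=
    (measurable_const.div (measurable_const.sub measurable_subtype_coe)).ennreal_ofReal
  refine ⟨σ.real {1}, measureReal_nonneg, Measure.map g (σ.withDensity d), ?_, fun γ hγ => ?_⟩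
  · rw [Measure.restrict_map hg measurableSet_Ioi, hpre, restrict_withDensity hS,
      lintegral_map (by fun_prop) hg, lintegral_withDensity_eq_lintegral_mul _ hd (by fun_prop)]
    refine lt_of_le_of_lt (setLIntegral_mono (g := fun _ => 2) measurable_const fun w hw => ?_) ?_
    · obtain ⟨h0, h1⟩ := hS_lt w hw
      have hgw : 0 ≤ g w := by
        have : w ∈ g ⁻¹' Ioi 0 := hpre ▸ hw
        exact (mem_Ioi.1 this).le
      have h2 := min_one_le_two_mul_one_sub_exp_neg hgw
      rw [hexp w hw] at h2
      simp only [Pi.mul_apply, d]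
      rw [← ENNReal.ofReal_mul (by rw [one_div_nonneg]; linarith)]
      refine (ENNReal.ofReal_le_ofReal (q := 2) ?_).trans (by simp)
      rw [one_div, inv_mul_le_iff₀ (by linarith)]
      linarith
    · rw [lintegral_const]
      exact ENNReal.mul_lt_top (by simp) (measure_lt_top _ _)
  · have hint := integrable_bernsteinKernel hγ σ
    have h1 : ∫ r in Ioi (0 : ℝ), (1 - Real.exp (-γ * r)) ∂(Measure.map g (σ.withDensity d)) =
        ∫ w in S, bernsteinKernel γ w ∂σ := by
      rw [Measure.restrict_map hg measurableSet_Ioi, hpre, restrict_withDensity hS,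
        integral_map hg.aemeasurable (by fun_prop),
        integral_withDensity_eq_integral_toReal_smul hd (by simp [d])]
      refine setIntegral_congr_fun hS fun w hw => ?_
      obtain ⟨h0, h1⟩ := hS_lt w hw
      have h2 : Real.exp (-γ * g w) = (w : ℝ) ^ γ := by
        rw [Real.rpow_def_of_pos h0]
        congr 1
        simp only [g]
        ring
      simp only [d, h2]
      rw [ENNReal.toReal_ofReal (by rw [one_div_nonneg]; linarith),
        bernsteinKernel_of_ne γ h1.ne, smul_eq_mul]
      ring
    have hSc : ({0}ᶜ : Set unitInterval) = {1} ∪ S := by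
      ext w
      simp only [mem_compl_iff, mem_singleton_iff, mem_union, S]
      have : w = 1 → w ≠ 0 := by rintro rfl; exact one_ne_zero
      change ¬ w = 0 ↔ w = 1 ∨ (w ≠ 0 ∧ w ≠ 1)
      tauto
    rw [h1, hσ γ hγ, hf₀',
      ← integral_add_compl (measurableSet_singleton (0 : unitInterval)) hint, hSc,
      setIntegral_union (by simp [S]) hS hint.integrableOn hint.integrableOn,
      integral_singleton, integral_singleton]
    simp only [Icc.coe_zero, Icc.coe_one, bernsteinKernel_zero_right hγ,
      bernsteinKernel_one_right, smul_eq_mul]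
    ring

/-- Truncated generating polynomials of the first passage times of a killed simple random walk
with survival weights `β`. -/
noncomputable def passagePoly (β : ℕ → ℝ) : ℕ → ℕ → Polynomial ℝ
  | 0, _ => 0
  | m + 1, k => Polynomial.C (β k) *
      (Polynomial.X * (1 + passagePoly β m k * passagePoly β m (k + 1)))

section PassagePoly

variable {β : ℕ → ℝ}

lemma passagePoly_coeff_nonneg (hβ : ∀ k, 0 ≤ β k) (m k i : ℕ) :
    0 ≤ (passagePoly β m k).coeff i := by
  induction m generalizing k i with
  | zero => simp [passagePoly]
  | succ m ih =>
    rw [passagePoly, Polynomial.coeff_C_mul]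
    refine mul_nonneg (hβ k) ?_
    cases i with
    | zero => simp
    | succ i =>
      rw [Polynomial.coeff_X_mul, Polynomial.coeff_add, Polynomial.coeff_mul]
      refine add_nonneg ?_ (Finset.sum_nonneg fun x _ => mul_nonneg (ih _ _) (ih _ _))
      rw [Polynomial.coeff_one]
      split_ifs <;> norm_num

lemma passagePoly_eval_succ (m k : ℕ) (z : ℝ) :
    (passagePoly β (m + 1) k).eval z =
      β k * (z * (1 + (passagePoly β m k).eval z * (passagePoly β m (k + 1)).eval z)) := by
  simp [passagePoly]

lemma passagePoly_eval_mem (hβ : ∀ k, 0 ≤ β k) (hβ' : ∀ k, β k ≤ 1 / 2) {z : ℝ} (hz : 0 ≤ z)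
    (hz1 : z ≤ 1) (m k : ℕ) :
    0 ≤ (passagePoly β m k).eval z ∧ (passagePoly β m k).eval z ≤ 1 := by
  induction m generalizing k with
  | zero => simp [passagePoly]
  | succ m ih =>
    rw [passagePoly_eval_succ]
    obtain ⟨h0, h1⟩ := ih k
    obtain ⟨h0', h1'⟩ := ih (k + 1)
    have hmul := mul_nonneg h0 h0'
    have hmul1 := mul_le_one₀ h1 h0' h1'
    have := hβ k
    refine ⟨by positivity, ?_⟩
    calc _ ≤ (1 / 2 : ℝ) * (1 * (1 + 1)) := by
          gcongr
          exact hβ' k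
      _ = 1 := by norm_num

lemma abs_sub_passagePoly_le (hβ : ∀ k, 0 ≤ β k) (hβ' : ∀ k, β k ≤ 1 / 2) {z : ℝ} (hz : 0 ≤ z)
    (hz1 : z < 1) {r : ℕ → ℝ} {ε : ℝ} (hr : ∀ k, 0 ≤ r k ∧ r k ≤ 1)
    (hε : ∀ k, |r k - β k * (z * (1 + r k * r (k + 1)))| ≤ ε) (m k : ℕ) :
    |r k - (passagePoly β m k).eval z| ≤ z ^ m + ε / (1 - z) := by
  have hε0 : 0 ≤ ε := (abs_nonneg _).trans (hε 0)
  have hz' : 0 < 1 - z := sub_pos.2 hz1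
  induction m generalizing k with
  | zero =>
    simp only [passagePoly, Polynomial.eval_zero, sub_zero, pow_zero, abs_of_nonneg (hr k).1]
    have : 0 ≤ ε / (1 - z) := div_nonneg hε0 hz'.le
    linarith [(hr k).2]
  | succ m ih =>
    rw [passagePoly_eval_succ]
    set p := (passagePoly β m k).eval z with hp
    set q := (passagePoly β m (k + 1)).eval z with hq
    set E := z ^ m + ε / (1 - z) with hE
    have hpm := passagePoly_eval_mem hβ hβ' hz hz1.le m k
    have hE0 : 0 ≤ E := (abs_nonneg _).trans (ih k)
    have h1 : |r k * r (k + 1) - p * q| ≤ 2 * E := by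
      have : r k * r (k + 1) - p * q = (r k - p) * r (k + 1) + p * (r (k + 1) - q) := by ring
      rw [this]
      refine (abs_add_le _ _).trans ?_
      rw [abs_mul, abs_mul, abs_of_nonneg (hr (k + 1)).1, abs_of_nonneg hpm.1, two_mul]
      exact add_le_add ((mul_le_of_le_one_right (abs_nonneg _) (hr (k + 1)).2).trans (ih k))
        ((mul_le_of_le_one_left (abs_nonneg _) hpm.2).trans (ih (k + 1)))
    have h2 : |β k * (z * (r k * r (k + 1) - p * q))| ≤ z * E := by
      rw [abs_mul, abs_mul, abs_of_nonneg (hβ k), abs_of_nonneg hz]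
      calc _ ≤ 1 / 2 * (z * (2 * E)) := by
            gcongr
            exact hβ' k
        _ = z * E := by ring
    have h3 : r k - β k * (z * (1 + p * q)) =
        (r k - β k * (z * (1 + r k * r (k + 1)))) + β k * (z * (r k * r (k + 1) - p * q)) := by
      ring
    rw [h3]
    refine (abs_add_le _ _).trans ((add_le_add (hε k) h2).trans (le_of_eq ?_))
    rw [hE, pow_succ]
    field_simp
    ring

end PassagePoly

/-- The coefficients of `Γ(v + 1) (x / 2) ^ (-v) I_v(x)` as a power series in `x ^ 2`. -/
noncomputable def besselCoeff (v : ℝ) (n : ℕ) : ℝ :=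
  ∏ i ∈ Finset.range n, 1 / (4 * ((i : ℝ) + 1) * (v + i + 1))

/-- The normalized modified Bessel function `2 ^ v Γ(v + 1) I_v(x)`. -/
noncomputable def besselU (v x : ℝ) : ℝ := x ^ v * ∑' n : ℕ, besselCoeff v n * x ^ (2 * n)

section Bessel

variable {v : ℝ}

lemma besselCoeff_succ (v : ℝ) (n : ℕ) :
    besselCoeff v (n + 1) = besselCoeff v n * (1 / (4 * ((n : ℝ) + 1) * (v + n + 1))) :=
  Finset.prod_range_succ _ _

lemma besselCoeff_pos (hv : 0 ≤ v) (n : ℕ) : 0 < besselCoeff v n :=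
  Finset.prod_pos fun i _ => by positivity

lemma besselCoeff_le (hv : 0 ≤ v) (n : ℕ) : besselCoeff v n ≤ 1 / (n.factorial : ℝ) := by
  induction n with
  | zero => simp [besselCoeff]
  | succ n ih =>
    rw [besselCoeff_succ, Nat.factorial_succ, Nat.cast_mul, mul_comm ((n + 1 : ℕ) : ℝ),
      ← one_div_mul_one_div (n.factorial : ℝ)]
    refine mul_le_mul ih ?_ (by positivity) (by positivity)
    push_cast
    refine one_div_le_one_div_of_le (by positivity) ?_
    nlinarith [mul_nonneg (n.cast_nonneg : (0 : ℝ) ≤ n) (add_nonneg hv (n.cast_nonneg)),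
      (n.cast_nonneg : (0 : ℝ) ≤ n)]

lemma summable_besselCoeff_mul (hv : 0 ≤ v) {φ : ℕ → ℝ} {C Y : ℝ}
    (hφ : ∀ n, |φ n| ≤ C * Y ^ n) : Summable fun n => besselCoeff v n * φ n := by
  refine Summable.of_norm_bounded ((Real.summable_pow_div_factorial Y).mul_left C) fun n => ?_
  rw [Real.norm_eq_abs, abs_mul, abs_of_pos (besselCoeff_pos hv n)]
  calc _ ≤ 1 / (n.factorial : ℝ) * (C * Y ^ n) :=
        mul_le_mul (besselCoeff_le hv n) (hφ n) (abs_nonneg _) (by positivity)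
    _ = _ := by ring

lemma summable_besselCoeff_mul_pow (hv : 0 ≤ v) (x : ℝ) :
    Summable fun n => besselCoeff v n * x ^ (2 * n) :=
  summable_besselCoeff_mul hv (C := 1) (Y := x ^ 2) fun n => by
    rw [one_mul, pow_mul, abs_of_nonneg (by positivity)]

lemma rpow_le_besselU (hv : 0 ≤ v) {x : ℝ} (hx : 0 < x) : x ^ v ≤ besselU v x := by
  refine le_mul_of_one_le_right (by positivity) ?_
  have := (summable_besselCoeff_mul_pow hv x).le_tsum 0 fun n _ =>
    mul_nonneg (besselCoeff_pos hv n).le (by positivity)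
  simpa [besselCoeff] using this

lemma besselU_pos (hv : 0 ≤ v) {x : ℝ} (hx : 0 < x) : 0 < besselU v x :=
  (Real.rpow_pos_of_pos hx v).trans_le (rpow_le_besselU hv hx)

lemma besselCoeff_mul_Gamma (hv : 0 ≤ v) (n : ℕ) :
    besselCoeff v n * (4 ^ n * (n.factorial * Real.Gamma (v + n + 1))) = Real.Gamma (v + 1) := by
  induction n with
  | zero => simp [besselCoeff]
  | succ n ih =>
    have h : (0 : ℝ) < v + n + 1 := by positivity
    rw [besselCoeff_succ, Nat.factorial_succ, ← ih]
    push_cast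
    rw [show v + ((n : ℝ) + 1) + 1 = (v + n + 1) + 1 by ring, Real.Gamma_add_one h.ne']
    field_simp
    ring

lemma besselI_eq (hv : 0 ≤ v) {x : ℝ} (hx : 0 < x) :
    besselI v x = besselU v x / (2 ^ v * Real.Gamma (v + 1)) := by
  have hΓ : 0 < Real.Gamma (v + 1) := Real.Gamma_pos_of_pos (by linarith)
  rw [besselI, besselU, mul_div_right_comm, ← tsum_mul_left]
  refine tsum_congr fun n => ?_
  have hΓn : 0 < Real.Gamma (v + n + 1) := Real.Gamma_pos_of_pos (by positivity)
  have h2v : (0 : ℝ) < 2 ^ v := by positivity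
  rw [Real.rpow_add (by positivity), Real.div_rpow hx.le zero_le_two,
    show (2 * (n : ℝ)) = ((2 * n : ℕ) : ℝ) by push_cast; ring, Real.rpow_natCast, div_pow,
    ← besselCoeff_mul_Gamma hv n, pow_mul 2 2 n]
  have := besselCoeff_pos hv n
  norm_num
  field_simp

lemma continuousOn_besselU {x : ℝ} (hx : 0 < x) :
    ContinuousOn (fun v => besselU v x) (Ici 0) := by
  refine (Real.continuous_const_rpow hx.ne').continuousOn.mul ?_
  have hu : Summable fun n : ℕ => (x ^ 2) ^ n / (n.factorial : ℝ) :=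
    Real.summable_pow_div_factorial (x ^ 2)
  refine continuousOn_tsum (fun n => ?_) hu fun n v hv => ?_
  · have h : ContinuousOn (fun v => besselCoeff v n) (Ici 0) := by
      unfold besselCoeff
      refine continuousOn_finsetProd _ fun i _ => ?_
      refine continuousOn_const.div (by fun_prop) fun v hv => ?_
      have : 0 ≤ v := hv
      positivity
    exact h.mul continuousOn_const
  · have hv : 0 ≤ v := hv
    have := besselCoeff_pos hv n
    rw [Real.norm_of_nonneg (by positivity), pow_mul, div_eq_mul_one_div, mul_comm]
    exact mul_le_mul_of_nonneg_left (besselCoeff_le hv n) (by positivity)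

lemma besselU_exp_mul (v h : ℝ) {x : ℝ} (hx : 0 < x) :
    besselU v (Real.exp h * x) =
      x ^ v * ∑' n : ℕ, besselCoeff v n * (x ^ (2 * n) * Real.exp ((v + 2 * n) * h)) := by
  rw [besselU, Real.mul_rpow (Real.exp_pos h).le hx.le, mul_comm (Real.exp h ^ v), mul_assoc,
    ← tsum_mul_left]
  congr 1
  refine tsum_congr fun n => ?_
  rw [mul_pow, ← Real.exp_mul, ← Real.exp_nat_mul, add_mul, Real.exp_add]
  push_cast
  ring_nf

lemma tsum_besselCoeff_mul_sq (hv : 0 ≤ v) (x : ℝ) :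
    ∑' n : ℕ, besselCoeff v n * (x ^ (2 * n) * ((v + 2 * n) ^ 2 - v ^ 2)) =
      x ^ 2 * ∑' n : ℕ, besselCoeff v n * x ^ (2 * n) := by
  have hshift : ∀ n : ℕ, besselCoeff v (n + 1) *
      (x ^ (2 * (n + 1)) * ((v + 2 * ((n + 1 : ℕ) : ℝ)) ^ 2 - v ^ 2)) =
      x ^ 2 * (besselCoeff v n * x ^ (2 * n)) := fun n => by
    rw [besselCoeff_succ]
    have : v + n + 1 ≠ 0 := by positivity
    push_cast
    field_simp
    ring
  have hs : Summable fun n : ℕ =>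
      besselCoeff v n * (x ^ (2 * n) * ((v + 2 * (n : ℝ)) ^ 2 - v ^ 2)) := by
    rw [← summable_nat_add_iff 1]
    simp only [hshift]
    exact (summable_besselCoeff_mul_pow hv x).mul_left _
  rw [hs.tsum_eq_zero_add]
  simp only [hshift, tsum_mul_left]
  simp

lemma two_cosh_sub_bounds {y : ℝ} (hy : 0 ≤ y) :
    0 ≤ Real.exp y + Real.exp (-y) - 2 - y ^ 2 ∧
      Real.exp y + Real.exp (-y) - 2 - y ^ 2 ≤ 2 * (y ^ 4 * Real.exp y) := by
  have hc := Real.hasSum_cosh y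
  have h1 := hc.summable.sum_add_tsum_nat_add 2
  rw [hc.tsum_eq] at h1
  simp only [Finset.sum_range_succ, Finset.sum_range_zero] at h1
  norm_num at h1
  have hs := (summable_nat_add_iff 2).2 hc.summable
  have h0 : 0 ≤ ∑' n : ℕ, y ^ (2 * (n + 2)) / ((2 * (n + 2)).factorial : ℝ) :=
    tsum_nonneg fun n => by positivity
  have h2 : ∑' n : ℕ, y ^ (2 * (n + 2)) / ((2 * (n + 2)).factorial : ℝ) ≤ y ^ 4 * Real.cosh y := by
    rw [← hc.tsum_eq, ← tsum_mul_left]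
    refine hs.tsum_le_tsum (fun n => ?_) (hc.summable.mul_left _)
    rw [show 2 * (n + 2) = 4 + 2 * n by ring, pow_add, mul_div_assoc]
    refine mul_le_mul_of_nonneg_left ?_ (by positivity)
    refine div_le_div_of_nonneg_left (by positivity) (by positivity) ?_
    exact_mod_cast Nat.factorial_le (by omega)
  have h3 : Real.cosh y ≤ Real.exp y := by
    rw [← Real.cosh_add_sinh]
    linarith [Real.sinh_nonneg_iff.2 hy]
  have h4 : y ^ 4 * Real.cosh y ≤ y ^ 4 * Real.exp y :=
    mul_le_mul_of_nonneg_left h3 (by positivity)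
  rw [Real.cosh_eq] at h1 h2 h4
  constructor <;> linarith

lemma pow_four_le_exp {y : ℝ} (hy : 0 ≤ y) : y ^ 4 ≤ 24 * Real.exp y := by
  have := Real.pow_div_factorial_le_exp y hy 4
  rw [div_le_iff₀ (by positivity)] at this
  simpa [Nat.factorial, mul_comm] using this

lemma summable_besselCoeff_mul_exp (hv : 0 ≤ v) (x h : ℝ) :
    Summable fun n : ℕ => besselCoeff v n * (x ^ (2 * n) * Real.exp ((v + 2 * n) * h)) := by
  refine summable_besselCoeff_mul hv (C := Real.exp (v * h)) (Y := x ^ 2 * Real.exp (2 * h))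
    fun n => le_of_eq ?_
  rw [pow_mul, abs_of_nonneg (by positivity), mul_pow, ← Real.exp_nat_mul, add_mul, Real.exp_add]
  ring_nf

/-- The multiplicative second difference of `besselU v` is governed by the modified Bessel
equation `(x d/dx)² u = (v² + x²) u`. -/
lemma exists_besselU_second_difference_le (hv : 0 ≤ v) (A : ℝ) :
    ∃ C : ℝ, 0 ≤ C ∧ ∀ h x : ℝ, 0 ≤ h → h ≤ 1 → 0 < x → x ≤ A →
      |besselU v (Real.exp h * x) + besselU v (Real.exp (-h) * x) -
        (2 + h ^ 2 * (v ^ 2 + x ^ 2)) * besselU v x| ≤ C * h ^ 4 * besselU v x := by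
  set B : ℕ → ℝ := fun n => A ^ (2 * n) * Real.exp ((v + 2 * n) * 2) with hB
  have hBs := summable_besselCoeff_mul_exp hv A 2
  refine ⟨48 * ∑' n, besselCoeff v n * B n, ?_, fun h x h0 h1 hx hxA => ?_⟩
  · exact mul_nonneg (by norm_num) (tsum_nonneg fun n =>
      mul_nonneg (besselCoeff_pos hv n).le
        (mul_nonneg (by rw [pow_mul]; positivity) (Real.exp_pos _).le))
  have hs1 := summable_besselCoeff_mul_exp hv x h
  have hs2 := summable_besselCoeff_mul_exp hv x (-h)
  have hs0 := summable_besselCoeff_mul_pow hv x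
  have hsq := tsum_besselCoeff_mul_sq hv x
  have hs3 : Summable fun n : ℕ =>
      besselCoeff v n * (x ^ (2 * n) * ((v + 2 * n) ^ 2 - v ^ 2)) := by
    by_contra hns
    rw [tsum_eq_zero_of_not_summable hns] at hsq
    have h1 := rpow_le_besselU hv hx
    have h2 := Real.rpow_pos_of_pos hx v
    have : besselU v x = 0 := by
      rw [besselU, (mul_eq_zero.1 hsq.symm).resolve_left (by positivity), mul_zero]
    linarith
  set R : ℕ → ℝ := fun n => Real.exp ((v + 2 * n) * h) + Real.exp (-((v + 2 * n) * h)) - 2 -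
    ((v + 2 * n) * h) ^ 2 with hR
  have hRb : ∀ n, 0 ≤ R n ∧ R n ≤ 2 * (((v + 2 * n) * h) ^ 4 * Real.exp ((v + 2 * n) * h)) :=
    fun n => two_cosh_sub_bounds (by positivity)
  have hterm : ∀ n, besselCoeff v n * (x ^ (2 * n) * R n) ≤ 48 * h ^ 4 * (besselCoeff v n * B n) :=
    fun n => by
    have hy : 0 ≤ v + 2 * (n : ℝ) := by positivity
    have e1 : R n ≤ 48 * h ^ 4 * Real.exp ((v + 2 * n) * 2) := by
      calc R n ≤ 2 * (((v + 2 * n) * h) ^ 4 * Real.exp ((v + 2 * n) * h)) := (hRb n).2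
        _ = 2 * h ^ 4 * ((v + 2 * n) ^ 4 * Real.exp ((v + 2 * n) * h)) := by ring
        _ ≤ 2 * h ^ 4 * (24 * Real.exp (v + 2 * n) * Real.exp ((v + 2 * n) * 1)) := by
            gcongr
            exact pow_four_le_exp hy
        _ = 48 * h ^ 4 * Real.exp ((v + 2 * n) * 2) := by
            rw [mul_one, mul_two, Real.exp_add (v + 2 * (n : ℝ))]; ring
    have e2 : x ^ (2 * n) * R n ≤ A ^ (2 * n) * (48 * h ^ 4 * Real.exp ((v + 2 * n) * 2)) :=
      mul_le_mul (pow_le_pow_left₀ hx.le hxA _) e1 (hRb n).1 (pow_nonneg (hx.le.trans hxA) _)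
    calc _ ≤ besselCoeff v n * (A ^ (2 * n) * (48 * h ^ 4 * Real.exp ((v + 2 * n) * 2))) :=
          mul_le_mul_of_nonneg_left e2 (besselCoeff_pos hv n).le
      _ = _ := by simp only [hB]; ring
  have hterm0 : ∀ n, 0 ≤ besselCoeff v n * (x ^ (2 * n) * R n) := fun n =>
    mul_nonneg (besselCoeff_pos hv n).le (mul_nonneg (by positivity) (hRb n).1)
  have hsum : HasSum (fun n => besselCoeff v n * (x ^ (2 * n) * R n))
      ((∑' n : ℕ, besselCoeff v n * (x ^ (2 * n) * Real.exp ((v + 2 * n) * h))) +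
        (∑' n : ℕ, besselCoeff v n * (x ^ (2 * n) * Real.exp ((v + 2 * n) * (-h)))) -
        (2 + h ^ 2 * v ^ 2) * (∑' n : ℕ, besselCoeff v n * x ^ (2 * n)) -
        h ^ 2 * (x ^ 2 * ∑' n : ℕ, besselCoeff v n * x ^ (2 * n))) := by
    rw [← hsq]
    refine (((hs1.hasSum.add hs2.hasSum).sub (hs0.hasSum.mul_left _)).sub
      (hs3.hasSum.mul_left _)).congr_fun fun n => ?_
    simp only [hR, mul_neg]
    ring
  have hdiff : besselU v (Real.exp h * x) + besselU v (Real.exp (-h) * x) -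
        (2 + h ^ 2 * (v ^ 2 + x ^ 2)) * besselU v x =
      x ^ v * ∑' n, besselCoeff v n * (x ^ (2 * n) * R n) := by
    rw [besselU_exp_mul v h hx, besselU_exp_mul v (-h) hx, hsum.tsum_eq, besselU]
    ring
  rw [hdiff, abs_of_nonneg (mul_nonneg (by positivity) (tsum_nonneg hterm0)), mul_comm]
  refine mul_le_mul ?_ (rpow_le_besselU hv hx) (by positivity) ?_
  · refine (hsum.summable.tsum_le_tsum hterm (hBs.mul_left _)).trans (le_of_eq ?_)
    rw [tsum_mul_left]
    ring
  · exact mul_nonneg (mul_nonneg (by norm_num) (tsum_nonneg fun n =>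
      mul_nonneg (besselCoeff_pos hv n).le
        (mul_nonneg (by rw [pow_mul]; positivity) (Real.exp_pos _).le))) (by positivity)

lemma exists_besselU_difference_le (hv : 0 ≤ v) (A : ℝ) :
    ∃ C : ℝ, 0 ≤ C ∧ ∀ h x : ℝ, 0 ≤ h → h ≤ 1 → 0 < x → x ≤ A →
      0 ≤ besselU v (Real.exp h * x) - besselU v x ∧
      besselU v (Real.exp h * x) - besselU v x ≤ C * h * besselU v x := by
  set B : ℕ → ℝ := fun n => A ^ (2 * n) * Real.exp ((v + 2 * n) * 2) with hB
  have hBs := summable_besselCoeff_mul_exp hv A 2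
  have hB0 : 0 ≤ ∑' n, besselCoeff v n * B n := tsum_nonneg fun n =>
    mul_nonneg (besselCoeff_pos hv n).le
      (mul_nonneg (by rw [pow_mul]; positivity) (Real.exp_pos _).le)
  refine ⟨∑' n, besselCoeff v n * B n, hB0, fun h x h0 h1 hx hxA => ?_⟩
  have hsum : HasSum (fun n : ℕ => besselCoeff v n * (x ^ (2 * n) *
      (Real.exp ((v + 2 * n) * h) - 1))) _ :=
    ((summable_besselCoeff_mul_exp hv x h).hasSum.sub
      (summable_besselCoeff_mul_pow hv x).hasSum).congr_fun fun n => by ring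
  have hterm0 : ∀ n : ℕ, 0 ≤ besselCoeff v n * (x ^ (2 * n) *
      (Real.exp ((v + 2 * n) * h) - 1)) := fun n => by
    have : 1 ≤ Real.exp ((v + 2 * n) * h) := Real.one_le_exp (by positivity)
    exact mul_nonneg (besselCoeff_pos hv n).le (mul_nonneg (by positivity) (by linarith))
  have hterm : ∀ n : ℕ, besselCoeff v n * (x ^ (2 * n) *
      (Real.exp ((v + 2 * n) * h) - 1)) ≤ h * (besselCoeff v n * B n) := fun n => by
    have hy : 0 ≤ v + 2 * (n : ℝ) := by positivity
    have e1 : Real.exp ((v + 2 * n) * h) - 1 ≤ h * Real.exp ((v + 2 * n) * 2) := by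
      have e3 : Real.exp ((v + 2 * n) * h) - 1 ≤
          (v + 2 * n) * h * Real.exp ((v + 2 * n) * h) := by
        have := Real.add_one_le_exp (-((v + 2 * n) * h))
        have h3 := mul_le_mul_of_nonneg_right this (Real.exp_pos ((v + 2 * n) * h)).le
        rw [← Real.exp_add, neg_add_cancel, Real.exp_zero] at h3
        linarith
      calc _ ≤ (v + 2 * n) * h * Real.exp ((v + 2 * n) * h) := e3
        _ ≤ Real.exp (v + 2 * n) * h * Real.exp ((v + 2 * n) * 1) := by
            gcongr
            linarith [Real.add_one_le_exp (v + 2 * (n : ℝ))]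
        _ = _ := by rw [mul_one, mul_two, Real.exp_add (v + 2 * (n : ℝ))]; ring
    have e0 : 0 ≤ Real.exp ((v + 2 * n) * h) - 1 := by
      linarith [Real.one_le_exp (show 0 ≤ (v + 2 * (n : ℝ)) * h by positivity)]
    have e2 : x ^ (2 * n) * (Real.exp ((v + 2 * n) * h) - 1) ≤
        A ^ (2 * n) * (h * Real.exp ((v + 2 * n) * 2)) :=
      mul_le_mul (pow_le_pow_left₀ hx.le hxA _) e1 e0 (pow_nonneg (hx.le.trans hxA) _)
    calc _ ≤ besselCoeff v n * (A ^ (2 * n) * (h * Real.exp ((v + 2 * n) * 2))) :=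
          mul_le_mul_of_nonneg_left e2 (besselCoeff_pos hv n).le
      _ = _ := by simp only [hB]; ring
  have hdiff : besselU v (Real.exp h * x) - besselU v x =
      x ^ v * ∑' n : ℕ, besselCoeff v n * (x ^ (2 * n) * (Real.exp ((v + 2 * n) * h) - 1)) := by
    rw [besselU_exp_mul v h hx, hsum.tsum_eq, besselU]
    ring
  rw [hdiff]
  refine ⟨mul_nonneg (by positivity) (tsum_nonneg hterm0), ?_⟩
  rw [mul_comm]
  refine mul_le_mul ?_ (rpow_le_besselU hv hx) (by positivity) (mul_nonneg hB0 h0)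
  refine (hsum.summable.tsum_le_tsum hterm (hBs.mul_left _)).trans (le_of_eq ?_)
  rw [tsum_mul_left]
  ring

end Bessel

lemma exists_besselU_ratio_recursion_le {γ : ℝ} (hγ : 0 < γ) (A : ℝ) :
    ∃ C : ℝ, 0 ≤ C ∧ ∀ h x : ℝ, 0 ≤ h → h ≤ 1 → γ * h ^ 2 ≤ 1 → 0 < x → x ≤ A →
      |besselU √(2 * γ) x / besselU √(2 * γ) (Real.exp h * x) -
        1 / (2 + h ^ 2 * x ^ 2) * (Real.exp (-(γ * h ^ 2)) *
          (1 + besselU √(2 * γ) x / besselU √(2 * γ) (Real.exp h * x) *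
            (besselU √(2 * γ) (Real.exp (-h) * x) / besselU √(2 * γ) x)))| ≤ C * h ^ 4 := by
  have hv : 0 ≤ √(2 * γ) := Real.sqrt_nonneg _
  have hv2 : √(2 * γ) ^ 2 = 2 * γ := Real.sq_sqrt (by positivity)
  obtain ⟨C₁, hC₁, hsecond⟩ := exists_besselU_second_difference_le hv A
  obtain ⟨C₂, -, hfirst⟩ := exists_besselU_difference_le hv A
  refine ⟨C₁ + ((2 + A ^ 2) * γ ^ 2 + A ^ 2 * γ), by positivity,
    fun h x h0 h1 hγh hx hxA => ?_⟩
  have hP := besselU_pos hv (mul_pos (Real.exp_pos h) hx)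
  have hQ := besselU_pos hv hx
  have hQP := (hfirst h x h0 h1 hx hxA).1
  have hb := hsecond h x h0 h1 hx hxA
  rw [hv2] at hb
  set P := besselU √(2 * γ) (Real.exp h * x)
  set Q := besselU √(2 * γ) x
  set M := besselU √(2 * γ) (Real.exp (-h) * x)
  set D := 2 + h ^ 2 * x ^ 2 with hD
  have hw := Real.exp_pos (γ * h ^ 2)
  have hw1 : 1 ≤ Real.exp (γ * h ^ 2) := Real.one_le_exp (by positivity)
  have ht : |Real.exp (γ * h ^ 2) - 1 - γ * h ^ 2| ≤ (γ * h ^ 2) ^ 2 :=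
    Real.abs_exp_sub_one_sub_id_le (by rwa [abs_of_nonneg (by positivity)])
  have hx2 : x ^ 2 ≤ A ^ 2 := pow_le_pow_left₀ hx.le hxA 2
  have hD1 : D ≤ 2 + A ^ 2 := by
    have : h ^ 2 * x ^ 2 ≤ 1 * A ^ 2 :=
      mul_le_mul (pow_le_one₀ h0 h1) hx2 (by positivity) zero_le_one
    linarith
  have hDpos : 2 ≤ D := le_add_of_nonneg_right (by positivity)
  rw [Real.exp_neg]
  set w := Real.exp (γ * h ^ 2)
  have hDw : 1 ≤ D * w := by nlinarith
  have hweight : |D * w - (2 + h ^ 2 * (2 * γ + x ^ 2))| ≤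
      ((2 + A ^ 2) * γ ^ 2 + A ^ 2 * γ) * h ^ 4 := by
    have e : D * w - (2 + h ^ 2 * (2 * γ + x ^ 2)) =
        D * (w - 1 - γ * h ^ 2) + x ^ 2 * (γ * h ^ 4) := by rw [hD]; ring
    rw [e]
    refine (abs_add_le _ _).trans ?_
    rw [abs_mul, abs_of_nonneg (by linarith : 0 ≤ D),
      abs_of_nonneg (by positivity : 0 ≤ x ^ 2 * (γ * h ^ 4))]
    calc _ ≤ (2 + A ^ 2) * (γ * h ^ 2) ^ 2 + A ^ 2 * (γ * h ^ 4) := by gcongr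
      _ = _ := by ring
  have hnum : |Q * (D * w) - (P + M)| ≤
      (C₁ + ((2 + A ^ 2) * γ ^ 2 + A ^ 2 * γ)) * h ^ 4 * Q := by
    have e : Q * (D * w) - (P + M) = Q * (D * w - (2 + h ^ 2 * (2 * γ + x ^ 2))) -
        (P + M - (2 + h ^ 2 * (2 * γ + x ^ 2)) * Q) := by ring
    rw [e]
    refine (abs_sub _ _).trans ?_
    rw [abs_mul, abs_of_pos hQ]
    have := mul_le_mul_of_nonneg_left hweight hQ.le
    linarith
  have hmain : Q / P - 1 / D * (w⁻¹ * (1 + Q / P * (M / Q))) =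
      (Q * (D * w) - (P + M)) / (P * (D * w)) := by
    have : D ≠ 0 := by linarith
    field_simp
  rw [hmain, abs_div, abs_of_pos (by positivity : 0 < P * (D * w)),
    div_le_iff₀ (by positivity)]
  refine hnum.trans (mul_le_mul_of_nonneg_left ?_ (by positivity))
  nlinarith

lemma abs_neg_log_sub_one_sub_le {r δ : ℝ} (hr : 0 < r) (hδ : 1 / r - 1 ≤ δ) (hr1 : r ≤ 1) :
    |-Real.log r - (1 - r)| ≤ δ ^ 2 := by
  have h1 := Real.log_le_sub_one_of_pos hr
  have h2 := Real.one_sub_inv_le_log_of_pos hr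
  rw [abs_of_nonneg (by linarith)]
  have h3 : 0 ≤ 1 / r - 1 := by rw [sub_nonneg, le_div_iff₀ hr]; linarith
  have h4 : 1 / r - 1 - (1 - r) ≤ (1 / r - 1) ^ 2 := by
    have : (1 / r - 1) ^ 2 - (1 / r - 1 - (1 - r)) = (1 / r - 1) ^ 2 * (1 - r) := by
      field_simp
    nlinarith [mul_nonneg (sq_nonneg (1 / r - 1)) (sub_nonneg.2 hr1)]
  have h5 := pow_le_pow_left₀ h3 hδ 2
  rw [← one_div] at h2
  linarith

/-- The approximation of `log (I_v(A) / I_v(a))`, `v = √(2γ)`, by first passage times of a killed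
simple random walk with `N` steps between `log a` and `log A`. -/
noncomputable def passageSum (a A : ℝ) (N : ℕ) (γ : ℝ) : ℝ :=
  ∑ k ∈ Finset.range N, (1 - (passagePoly (fun k => 1 / (2 + (Real.log (A / a) / N) ^ 2 *
    (Real.exp (-((k + 1 : ℕ) * (Real.log (A / a) / N))) * A) ^ 2)) (N ^ 3) k).eval
      (Real.exp (-(γ * (Real.log (A / a) / N) ^ 2))))

lemma one_div_two_add_mem {y : ℝ} (hy : 0 ≤ y) : 0 ≤ 1 / (2 + y) ∧ 1 / (2 + y) ≤ 1 / 2 :=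
  ⟨by positivity, one_div_le_one_div_of_le two_pos (by linarith)⟩

lemma isBernsteinFun_passageSum (a A : ℝ) (N : ℕ) : IsBernsteinFun (passageSum a A N) := by
  refine IsBernsteinFun.sum _ fun k _ => IsBernsteinFun.one_sub_eval
    (passagePoly_coeff_nonneg (fun k => (one_div_two_add_mem (by positivity)).1) _ _) ?_
    (sq_nonneg _)
  exact (passagePoly_eval_mem (fun k => (one_div_two_add_mem (by positivity)).1)
    (fun k => (one_div_two_add_mem (by positivity)).2) zero_le_one le_rfl _ _).2

lemma exists_abs_sub_passageSum_le {a A : ℝ} (ha : 0 < a) (haA : a < A) {γ : ℝ} (hγ : 0 < γ) :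
    ∃ C : ℝ, ∀ N : ℕ, 0 < N → Real.log (A / a) / N ≤ 1 → γ * (Real.log (A / a) / N) ^ 2 ≤ 1 →
      |(Real.log (besselU √(2 * γ) A) - Real.log (besselU √(2 * γ) a)) - passageSum a A N γ| ≤
        N * (C * (Real.log (A / a) / N) ^ 2 +
          Real.exp (-(γ * (Real.log (A / a) / N) ^ 2)) ^ (N ^ 3)) := by
  have hv : 0 ≤ √(2 * γ) := Real.sqrt_nonneg _
  have hA : 0 < A := ha.trans haA
  have hL : 0 < Real.log (A / a) := Real.log_pos (by rwa [one_lt_div ha])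
  obtain ⟨C₁, hC₁, hrec⟩ := exists_besselU_ratio_recursion_le hγ A
  obtain ⟨C₂, hC₂, hfirst⟩ := exists_besselU_difference_le hv A
  refine ⟨C₂ ^ 2 + 2 * C₁ / γ, fun N hN hh1 hγh => ?_⟩
  have hN' : (0 : ℝ) < N := by exact_mod_cast hN
  rw [passageSum]
  set h := Real.log (A / a) / N with hh
  have h0 : 0 < h := by positivity
  set x : ℕ → ℝ := fun k => Real.exp (-(k * h)) * A with hx
  have hxpos : ∀ k, 0 < x k := fun k => by positivity
  have hxA : ∀ k, x k ≤ A := fun k =>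
    mul_le_of_le_one_left hA.le (Real.exp_le_one_iff.2 (neg_nonpos.2 (by positivity)))
  have hxsucc : ∀ k, Real.exp h * x (k + 1) = x k := fun k => by
    simp only [hx]
    rw [← mul_assoc, ← Real.exp_add]
    congr 2
    push_cast
    ring
  have hxpred : ∀ k, Real.exp (-h) * x k = x (k + 1) := fun k => by
    rw [← hxsucc k, ← mul_assoc, ← Real.exp_add, neg_add_cancel, Real.exp_zero, one_mul]
  have hxN : x N = a := by
    simp only [hx, hh]
    rw [mul_div_cancel₀ _ hN'.ne', Real.exp_neg, Real.exp_log (by positivity)]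
    field_simp
  have hx0 : x 0 = A := by simp [hx]
  set u := besselU √(2 * γ)
  have hu : ∀ k, 0 < u (x k) := fun k => besselU_pos hv (hxpos k)
  set r : ℕ → ℝ := fun k => u (x (k + 1)) / u (x k) with hr
  have hr0 : ∀ k, 0 < r k := fun k => div_pos (hu _) (hu _)
  have hstep : ∀ k, 0 ≤ u (x k) - u (x (k + 1)) ∧
      u (x k) - u (x (k + 1)) ≤ C₂ * h * u (x (k + 1)) := fun k => by
    have := hfirst h (x (k + 1)) h0.le hh1 (hxpos _) (hxA _)
    rwa [hxsucc] at this
  have hr1 : ∀ k, r k ≤ 1 := fun k =>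
    (div_le_one (hu k)).2 (by linarith [(hstep k).1])
  have hrinv : ∀ k, 1 / r k - 1 ≤ C₂ * h := fun k => by
    simp only [hr]
    rw [one_div_div, sub_le_iff_le_add, div_le_iff₀ (hu _)]
    linarith [(hstep k).2]
  set β : ℕ → ℝ := fun k => 1 / (2 + h ^ 2 * (Real.exp (-((k + 1 : ℕ) * h)) * A) ^ 2) with hβ
  have hβ0 : ∀ k, 0 ≤ β k := fun k => (one_div_two_add_mem (by positivity)).1
  have hβ1 : ∀ k, β k ≤ 1 / 2 := fun k => (one_div_two_add_mem (by positivity)).2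
  set z := Real.exp (-(γ * h ^ 2)) with hz
  have hzlt : z < 1 := Real.exp_lt_one_iff.2 (neg_lt_zero.2 (by positivity))
  have hε : ∀ k, |r k - β k * (z * (1 + r k * r (k + 1)))| ≤ C₁ * h ^ 4 := fun k => by
    have := hrec h (x (k + 1)) h0.le hh1 hγh (hxpos _) (hxA _)
    rwa [hxsucc, hxpred] at this
  have happrox := abs_sub_passagePoly_le hβ0 hβ1 (Real.exp_pos _).le hzlt
    (fun k => ⟨(hr0 k).le, hr1 k⟩) hε (N ^ 3)
  have hdiv : C₁ * h ^ 4 / (1 - z) ≤ 2 * C₁ / γ * h ^ 2 := by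
    have e := min_one_le_two_mul_one_sub_exp_neg (by positivity : 0 ≤ γ * h ^ 2)
    rw [min_eq_right hγh] at e
    rw [div_le_iff₀ (sub_pos.2 hzlt)]
    calc C₁ * h ^ 4 = C₁ / γ * h ^ 2 * (γ * h ^ 2) := by field_simp
      _ ≤ C₁ / γ * h ^ 2 * (2 * (1 - z)) := by gcongr
      _ = _ := by ring
  have hlog : Real.log (u A) - Real.log (u a) = ∑ k ∈ Finset.range N, -Real.log (r k) := by
    have e : ∀ k, -Real.log (r k) = Real.log (u (x k)) - Real.log (u (x (k + 1))) := fun k => by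
      simp only [hr]
      rw [Real.log_div (hu _).ne' (hu _).ne']
      ring
    simp only [e]
    rw [Finset.sum_range_sub' (fun k => Real.log (u (x k))) N, hx0, hxN]
  rw [hlog, ← Finset.sum_sub_distrib]
  refine (Finset.abs_sum_le_sum_abs _ _).trans ((Finset.sum_le_card_nsmul _ _
    ((C₂ ^ 2 + 2 * C₁ / γ) * h ^ 2 + z ^ (N ^ 3)) fun k _ => ?_).trans_eq
      (by rw [Finset.card_range, nsmul_eq_mul]))
  have e1 := abs_neg_log_sub_one_sub_le (hr0 k) (hrinv k) (hr1 k)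
  have e2 := happrox k
  have e3 : -Real.log (r k) - (1 - (passagePoly β (N ^ 3) k).eval z) =
      (-Real.log (r k) - (1 - r k)) - (r k - (passagePoly β (N ^ 3) k).eval z) := by ring
  rw [e3]
  refine (abs_sub _ _).trans ?_
  nlinarith

lemma tendsto_passageSum {a A : ℝ} (ha : 0 < a) (haA : a < A) {γ : ℝ} (hγ : 0 < γ) :
    Tendsto (fun N => passageSum a A N γ) atTop
      (𝓝 (Real.log (besselU √(2 * γ) A) - Real.log (besselU √(2 * γ) a))) := by
  obtain ⟨C, hC⟩ := exists_abs_sub_passageSum_le ha haA hγ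
  have hL : 0 < Real.log (A / a) := Real.log_pos (by rwa [one_lt_div ha])
  set L := Real.log (A / a)
  have hh : Tendsto (fun N : ℕ => L / N) atTop (𝓝 0) := tendsto_const_div_atTop_nhds_zero_nat L
  have h1 : ∀ᶠ N : ℕ in atTop, L / N ≤ 1 := hh.eventually_le_const one_pos
  have h2 : ∀ᶠ N : ℕ in atTop, γ * (L / N) ^ 2 ≤ 1 := by
    have : Tendsto (fun N : ℕ => γ * (L / N) ^ 2) atTop (𝓝 (γ * 0 ^ 2)) :=
      (hh.pow 2).const_mul γ
    rw [zero_pow two_ne_zero, mul_zero] at this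
    exact this.eventually_le_const one_pos
  have hb : Tendsto (fun N : ℕ => C * L * (L / N) + (γ * L ^ 2)⁻¹ *
      ((γ * L ^ 2 * N) ^ 1 * Real.exp (-(γ * L ^ 2 * N)))) atTop (𝓝 0) := by
    have e1 : Tendsto (fun N : ℕ => γ * L ^ 2 * N) atTop atTop :=
      tendsto_natCast_atTop_atTop.const_mul_atTop (by positivity)
    have e2 := ((Real.tendsto_pow_mul_exp_neg_atTop_nhds_zero 1).comp e1).const_mul
      ((γ * L ^ 2)⁻¹)
    simpa using (hh.const_mul (C * L)).add e2
  rw [tendsto_iff_norm_sub_tendsto_zero]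
  refine squeeze_zero' (Eventually.of_forall fun N => norm_nonneg _) ?_ hb
  filter_upwards [h1, h2, eventually_gt_atTop 0] with N hN1 hN2 hN
  have hN' : (0 : ℝ) < N := by exact_mod_cast hN
  rw [Real.norm_eq_abs, abs_sub_comm]
  refine (hC N hN hN1 hN2).trans (le_of_eq ?_)
  rw [← Real.exp_nat_mul]
  have e : ((N ^ 3 : ℕ) : ℝ) * -(γ * (L / N) ^ 2) = -(γ * L ^ 2 * N) := by
    push_cast
    field_simp
  rw [e]
  field_simp

/-- Hartman's theorem (equation (1.3)): for `0 < a < A < ∞`,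
`γ ↦ I_{√(2γ)}(a) I_0(A) / (I_{√(2γ)}(A) I_0(a))` is the Laplace transform of an infinitely
divisible probability distribution on `[0,∞)`. -/
theorem hartman_bessel_infinitely_divisible (a A : ℝ) (ha : 0 < a) (haA : a < A) :
    ∃ c : ℝ, 0 ≤ c ∧ ∃ μ : Measure ℝ,
      (∫⁻ r in Ioi (0 : ℝ), ENNReal.ofReal (min 1 r) ∂μ < ⊤) ∧
      ∀ γ : ℝ, 0 ≤ γ →
        besselI (Real.sqrt (2 * γ)) a * besselI 0 A /
            (besselI (Real.sqrt (2 * γ)) A * besselI 0 a) =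
          Real.exp (-(c * γ + ∫ r in Ioi (0 : ℝ), (1 - Real.exp (-γ * r)) ∂μ)) := by
  have hA : 0 < A := ha.trans haA
  set F : ℝ → ℝ := fun γ => Real.log (besselU √(2 * γ) A) - Real.log (besselU √(2 * γ) a) with hF
  have hBF : IsBernsteinFun F :=
    IsBernsteinFun.of_tendsto (isBernsteinFun_passageSum a A) fun γ hγ =>
      tendsto_passageSum ha haA hγ
  have hlim : Tendsto F (𝓝[>] 0) (𝓝 (F 0)) := by
    have hsqrt : ContinuousOn (fun γ : ℝ => √(2 * γ)) univ := by fun_prop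
    have hU : ∀ x : ℝ, 0 < x → Continuous fun γ => Real.log (besselU √(2 * γ) x) := fun x hx =>
      continuousOn_univ.1 (((continuousOn_besselU hx).comp hsqrt
        fun γ _ => Real.sqrt_nonneg _).log fun γ _ => (besselU_pos (Real.sqrt_nonneg _) hx).ne')
    exact (((hU A hA).sub (hU a ha)).tendsto 0).mono_left nhdsWithin_le_nhds
  obtain ⟨c, hc, μ, hμ, hrep⟩ := hBF.exists_levy hlim
  have hratio : ∀ γ : ℝ, besselI √(2 * γ) a * besselI 0 A / (besselI √(2 * γ) A * besselI 0 a) =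
      Real.exp (-(F γ - F 0)) := fun γ => by
    have hv : 0 ≤ √(2 * γ) := Real.sqrt_nonneg _
    have hΓ : 0 < Real.Gamma (√(2 * γ) + 1) := Real.Gamma_pos_of_pos (by linarith)
    have h1 := besselU_pos hv ha
    have h2 := besselU_pos hv hA
    have h3 := besselU_pos le_rfl ha
    have h4 := besselU_pos le_rfl hA
    simp only [hF, mul_zero, Real.sqrt_zero]
    rw [besselI_eq hv ha, besselI_eq hv hA, besselI_eq le_rfl ha, besselI_eq le_rfl hA,
      neg_sub, Real.exp_sub, Real.exp_sub, Real.exp_sub, Real.exp_log h1, Real.exp_log h2,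
      Real.exp_log h3, Real.exp_log h4]
    simp only [zero_add, Real.rpow_zero, Real.Gamma_one, mul_one, div_one]
    field_simp
  refine ⟨c, hc, μ, hμ, fun γ hγ => ?_⟩
  rw [hratio]
  rcases hγ.eq_or_lt with rfl | hγ
  · simp
  · rw [hrep γ hγ]
end

section
/- (Corollary, Section 4.2, self-decomposability for the Mittag-Leffler function.) Let 1 < ρ < 2. Then there exist a ≥ 0 and a nonincreasing function k : (0,∞) → [0,∞) with ∫₀^∞ min(1,r)·(k(r)/r) dr < ∞ such that for all q ≥ 0: 1 / ( Γ(ρ)·E_{ρ,ρ}(q) ) = exp( −( a·q + ∫₀^∞ (1 − e^{−q·r})·(k(r)/r) dr ) ). In other words, q ↦ 1/(Γ(ρ)E_{ρ,ρ}(q)) is the Laplace transform of a self-decomposable probability distribution on [0,∞). (Note Γ(ρ)E_{ρ,ρ}(0) = 1; the normalizing factor Γ(ρ) is implicit in the paper.) -/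
open MeasureTheory Real Set Filter Topology

/-- The two-parameter Mittag-Leffler function `E_{ρ,β}(z) = Σ_{n≥0} z^n / Γ(ρn+β)`. -/
noncomputable def mittagLeffler (ρ β : ℝ) (x : ℝ) : ℝ :=
  ∑' n : ℕ, x ^ n / Real.Gamma (ρ * n + β)

/-! ### Negative binomial coefficients -/

/-- The coefficient of `X ^ n` in `(1 - X) ^ (-β)`. -/
noncomputable def negBinomCoeff (β : ℝ) : ℕ → ℝ
  | 0 => 1
  | n + 1 => negBinomCoeff β n * ((β + n) / (n + 1))

/-- The formal power series `(1 - X) ^ (-β)`. -/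
noncomputable def negBinomSeries (β : ℝ) : PowerSeries ℝ :=
  PowerSeries.mk (negBinomCoeff β)

lemma negBinomCoeff_succ (β : ℝ) (n : ℕ) :
    negBinomCoeff β (n + 1) = negBinomCoeff β n * ((β + n) / (n + 1)) := rfl

lemma negBinomSeries_ode (β : ℝ) :
    (1 - PowerSeries.X) * PowerSeries.derivative ℝ (negBinomSeries β) =
      PowerSeries.C β * negBinomSeries β := by
  ext n
  rw [sub_mul, one_mul, map_sub, PowerSeries.coeff_C_mul]
  have h : (n : ℝ) + 1 ≠ 0 := by positivity
  cases n with
  | zero =>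
    simp [negBinomSeries, PowerSeries.coeff_derivative, negBinomCoeff]
  | succ n =>
    rw [PowerSeries.coeff_succ_X_mul, PowerSeries.coeff_derivative, PowerSeries.coeff_derivative]
    simp only [negBinomSeries, PowerSeries.coeff_mk, negBinomCoeff_succ β (n + 1)]
    push_cast at h ⊢
    field_simp
    ring

lemma eq_of_ode (β : ℝ) (f g : PowerSeries ℝ)
    (hf : (1 - PowerSeries.X) * PowerSeries.derivative ℝ f = PowerSeries.C β * f)
    (hg : (1 - PowerSeries.X) * PowerSeries.derivative ℝ g = PowerSeries.C β * g)
    (h0 : PowerSeries.coeff 0 f = PowerSeries.coeff 0 g) : f = g := by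
  have key : ∀ (f : PowerSeries ℝ),
      (1 - PowerSeries.X) * PowerSeries.derivative ℝ f = PowerSeries.C β * f →
      ∀ n : ℕ, PowerSeries.coeff (n + 1) f * (n + 1) = (β + n) * PowerSeries.coeff n f := by
    intro f hf n
    have := congrArg (PowerSeries.coeff n) hf
    rw [sub_mul, one_mul, map_sub, PowerSeries.coeff_C_mul] at this
    cases n with
    | zero =>
      simpa [PowerSeries.coeff_derivative] using this
    | succ n =>
      rw [PowerSeries.coeff_succ_X_mul, PowerSeries.coeff_derivative,
        PowerSeries.coeff_derivative] at this
      push_cast at this ⊢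
      linarith
  ext n
  induction n with
  | zero => exact h0
  | succ n ih =>
    have h : (n : ℝ) + 1 ≠ 0 := by positivity
    apply mul_right_cancel₀ h
    rw [key f hf, key g hg, ih]

lemma negBinomSeries_mul (a b : ℝ) :
    negBinomSeries a * negBinomSeries b = negBinomSeries (a + b) := by
  apply eq_of_ode (a + b) _ _ _ (negBinomSeries_ode _)
  · simp [negBinomSeries, negBinomCoeff]
  · have ha := negBinomSeries_ode a
    have hb := negBinomSeries_ode b
    rw [Derivation.leibniz, smul_eq_mul, smul_eq_mul, map_add]
    linear_combination negBinomSeries a * hb + negBinomSeries b * ha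

lemma negBinomSeries_zero : negBinomSeries 0 = 1 := by
  apply eq_of_ode 0 _ _ (negBinomSeries_ode _)
  · simp
  · simp [negBinomSeries, negBinomCoeff]

lemma negBinomCoeff_pos {β : ℝ} (hβ : 0 < β) (n : ℕ) : 0 < negBinomCoeff β n := by
  induction n with
  | zero => exact one_pos
  | succ n ih => rw [negBinomCoeff_succ]; positivity

lemma negBinomCoeff_neg_nonneg {ρ : ℝ} (h1 : 1 < ρ) (h2 : ρ < 2) (n : ℕ) :
    0 ≤ negBinomCoeff (-ρ) (n + 2) := by
  induction n with
  | zero =>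
    simp only [negBinomCoeff]
    norm_num
    nlinarith
  | succ n ih =>
    rw [negBinomCoeff_succ]
    have hn : (0 : ℝ) ≤ n := n.cast_nonneg
    apply mul_nonneg ih
    push_cast
    apply div_nonneg <;> linarith

lemma negBinomCoeff_eq_Gamma {β : ℝ} (hβ : 0 < β) (n : ℕ) :
    negBinomCoeff β n = Real.Gamma (n + β) / (Real.Gamma β * Real.Gamma (n + 1)) := by
  have hΓ : Real.Gamma β ≠ 0 := (Real.Gamma_pos_of_pos hβ).ne'
  induction n with
  | zero => simp [negBinomCoeff, hΓ]
  | succ n ih =>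
    have h1 : (n : ℝ) + β ≠ 0 := by positivity
    have h2 : (n : ℝ) + 1 ≠ 0 := by positivity
    have h3 : Real.Gamma ((n : ℝ) + 1) ≠ 0 := (Real.Gamma_pos_of_pos (by positivity)).ne'
    rw [negBinomCoeff_succ, ih]
    push_cast
    rw [show (n : ℝ) + 1 + β = (n + β) + 1 by ring, Real.Gamma_add_one h1, Real.Gamma_add_one h2]
    field_simp
    ring

/-! ### Discrete scale functions -/

/-- The scale function of the upward skip-free random walk with generating function
`(1 - X) ^ ρ`, that is the coefficient of `X ^ n` in `1 / ((1 - X) ^ ρ - q X)`. -/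
noncomputable def discreteScale (ρ q : ℝ) (n : ℕ) : ℝ :=
  ∑ m ∈ Finset.range (n + 1), q ^ m * negBinomCoeff (ρ * (m + 1)) (n - m)

lemma discreteScale_eq_coeff (ρ q : ℝ) {n N : ℕ} (h : n < N) :
    discreteScale ρ q n = PowerSeries.coeff n (∑ m ∈ Finset.range N,
      PowerSeries.C (q ^ m) * (PowerSeries.X ^ m * negBinomSeries (ρ * (m + 1)))) := by
  rw [map_sum, discreteScale]
  simp only [PowerSeries.coeff_C_mul, PowerSeries.coeff_X_pow_mul']
  rw [← Finset.sum_subset (Finset.range_subset_range.2 (Nat.succ_le_of_lt h))]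
  · refine Finset.sum_congr rfl fun m hm => ?_
    rw [if_pos (Nat.lt_succ_iff.1 (Finset.mem_range.1 hm))]
    simp [negBinomSeries]
  · intro m _ hm
    rw [if_neg (fun h => hm (Finset.mem_range.2 (Nat.lt_succ_of_le h))), mul_zero]

lemma discreteScale_pos {ρ q : ℝ} (hρ : 0 < ρ) (hq : 0 ≤ q) (n : ℕ) : 0 < discreteScale ρ q n := by
  refine Finset.sum_pos' (fun m _ => ?_) ⟨0, by simp, ?_⟩
  · have := negBinomCoeff_pos (β := ρ * (m + 1)) (by positivity) (n - m)
    positivity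
  · have := negBinomCoeff_pos (β := ρ * ((0 : ℕ) + 1)) (by simpa) (n - 0)
    simpa using this

lemma discreteScale_convolution (ρ q : ℝ) (n : ℕ) :
    ∑ p ∈ Finset.HasAntidiagonal.antidiagonal (n + 1), negBinomCoeff (-ρ) p.1 * discreteScale ρ q p.2 =
      q * discreteScale ρ q n := by
  set S : PowerSeries ℝ := ∑ m ∈ Finset.range (n + 2),
      PowerSeries.C (q ^ m) * (PowerSeries.X ^ m * negBinomSeries (ρ * (m + 1))) with hS
  have h1 : ∑ p ∈ Finset.HasAntidiagonal.antidiagonal (n + 1), negBinomCoeff (-ρ) p.1 * discreteScale ρ q p.2 =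
      PowerSeries.coeff (n + 1) (negBinomSeries (-ρ) * S) := by
    rw [PowerSeries.coeff_mul]
    refine Finset.sum_congr rfl fun p hp => ?_
    have : p.2 < n + 2 := by
      have := Finset.HasAntidiagonal.mem_antidiagonal.1 hp
      omega
    rw [discreteScale_eq_coeff ρ q this, ← hS]
    simp [negBinomSeries]
  have h2 : negBinomSeries (-ρ) * S = 1 + PowerSeries.C q * (PowerSeries.X *
      ∑ m ∈ Finset.range (n + 1),
        PowerSeries.C (q ^ m) * (PowerSeries.X ^ m * negBinomSeries (ρ * (m + 1)))) := by
    have h3 : ∀ m : ℕ, negBinomSeries (-ρ) * negBinomSeries (ρ * (m + 1)) =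
        negBinomSeries (ρ * m) := by
      intro m
      rw [negBinomSeries_mul]
      congr 1
      ring
    rw [hS, Finset.sum_range_succ', mul_add, Finset.mul_sum, Finset.mul_sum, Finset.mul_sum,
      add_comm]
    congr 1
    · have := h3 0
      simp only [Nat.cast_zero, mul_zero, negBinomSeries_zero] at this
      simpa using this
    · refine Finset.sum_congr rfl fun m _ => ?_
      have := h3 (m + 1)
      push_cast at this ⊢
      rw [pow_succ, pow_succ, map_mul]
      linear_combination (PowerSeries.C (q ^ m) * PowerSeries.C q * PowerSeries.X ^ m *
        PowerSeries.X) * this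
  rw [h1, h2, map_add, PowerSeries.coeff_C_mul, PowerSeries.coeff_succ_X_mul,
    ← discreteScale_eq_coeff ρ q n.lt_succ_self]
  simp [PowerSeries.coeff_one]

lemma discreteScale_succ (ρ q : ℝ) (n : ℕ) :
    discreteScale ρ q (n + 1) = (q + ρ) * discreteScale ρ q n -
      ∑ j ∈ Finset.range n, negBinomCoeff (-ρ) (n - 1 - j + 2) * discreteScale ρ q j := by
  have h := discreteScale_convolution ρ q n
  rw [Finset.Nat.sum_antidiagonal_eq_sum_range_succ_mk, Finset.sum_range_succ',
    Finset.sum_range_succ'] at h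
  rw [← Finset.sum_range_reflect]
  have h1 : ∑ j ∈ Finset.range n, negBinomCoeff (-ρ) (n - 1 - (n - 1 - j) + 2) *
      discreteScale ρ q (n - 1 - j) = ∑ k ∈ Finset.range n, negBinomCoeff (-ρ) (k + 1 + 1) *
      discreteScale ρ q (n + 1 - (k + 1 + 1)) := by
    refine Finset.sum_congr rfl fun k hk => ?_
    have := Finset.mem_range.1 hk
    congr 2 <;> omega
  rw [h1]
  simp only [negBinomCoeff] at h ⊢
  simp at h ⊢
  linarith
/-! ### Laplace transforms of finite measures on `[0, ∞)` -/

open scoped NNReal ENNReal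

/-- `f` is, on `[0, ∞)`, the Laplace transform of a finite measure on `[0, ∞)`. -/
def IsLaplace (f : ℝ → ℝ) : Prop :=
  (∀ q, 0 ≤ q → 0 ≤ f q) ∧ ∃ ν : Measure ℝ≥0, ∀ q, 0 ≤ q →
    ∫⁻ x, ENNReal.ofReal (Real.exp (-(q * x))) ∂ν = ENNReal.ofReal (f q)

lemma isFiniteMeasure_of_lintegral_exp {f : ℝ → ℝ} {ν : Measure ℝ≥0}
    (h : ∀ q, 0 ≤ q → ∫⁻ x, ENNReal.ofReal (Real.exp (-(q * x))) ∂ν = ENNReal.ofReal (f q)) :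
    IsFiniteMeasure ν := by
  have := h 0 le_rfl
  simp at this
  exact ⟨by rw [this]; exact ENNReal.ofReal_lt_top⟩

lemma measurable_ofReal_exp (q : ℝ) :
    Measurable fun x : ℝ≥0 => ENNReal.ofReal (Real.exp (-(q * x))) := by fun_prop

namespace IsLaplace

lemma congr {f g : ℝ → ℝ} (hf : IsLaplace f) (h : ∀ q, 0 ≤ q → f q = g q) : IsLaplace g := by
  obtain ⟨h0, ν, hν⟩ := hf
  exact ⟨fun q hq => h q hq ▸ h0 q hq, ν, fun q hq => h q hq ▸ hν q hq⟩

lemma const {c : ℝ} (hc : 0 ≤ c) : IsLaplace fun _ => c := by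
  refine ⟨fun _ _ => hc, ENNReal.ofReal c • Measure.dirac 0, fun q _ => ?_⟩
  rw [lintegral_smul_measure, lintegral_dirac' _ (measurable_ofReal_exp q)]
  simp

lemma mul {f g : ℝ → ℝ} (hf : IsLaplace f) (hg : IsLaplace g) : IsLaplace fun q => f q * g q := by
  obtain ⟨hf0, μ, hμ⟩ := hf
  obtain ⟨hg0, ν, hν⟩ := hg
  have := isFiniteMeasure_of_lintegral_exp hμ
  have := isFiniteMeasure_of_lintegral_exp hν
  refine ⟨fun q hq => mul_nonneg (hf0 q hq) (hg0 q hq), μ.conv ν, fun q hq => ?_⟩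
  rw [Measure.lintegral_conv (measurable_ofReal_exp q), ENNReal.ofReal_mul (hf0 q hq),
    ← hμ q hq, ← hν q hq, ← lintegral_mul_const _ (measurable_ofReal_exp q)]
  refine lintegral_congr fun x => ?_
  rw [← lintegral_const_mul _ (measurable_ofReal_exp q)]
  refine lintegral_congr fun y => ?_
  rw [← ENNReal.ofReal_mul (Real.exp_pos _).le, ← Real.exp_add]
  congr 2
  push_cast
  ring

lemma pow {f : ℝ → ℝ} (hf : IsLaplace f) (n : ℕ) : IsLaplace fun q => f q ^ n := by
  induction n with
  | zero => simpa using const zero_le_one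
  | succ n ih => simpa only [pow_succ] using ih.mul hf

lemma tsum {f : ℕ → ℝ → ℝ} (hf : ∀ n, IsLaplace (f n))
    (hs : ∀ q, 0 ≤ q → Summable fun n => f n q) : IsLaplace fun q => ∑' n, f n q := by
  choose h0 ν hν using hf
  refine ⟨fun q hq => tsum_nonneg fun n => h0 n q hq, Measure.sum ν, fun q hq => ?_⟩
  rw [lintegral_sum_measure, ENNReal.ofReal_tsum_of_nonneg (fun n => h0 n q hq) (hs q hq)]
  exact tsum_congr fun n => hν n q hq

lemma add {f g : ℝ → ℝ} (hf : IsLaplace f) (hg : IsLaplace g) : IsLaplace fun q => f q + g q := by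
  obtain ⟨hf0, μ, hμ⟩ := hf
  obtain ⟨hg0, ν, hν⟩ := hg
  refine ⟨fun q hq => add_nonneg (hf0 q hq) (hg0 q hq), μ + ν, fun q hq => ?_⟩
  rw [lintegral_add_measure, hμ q hq, hν q hq, ENNReal.ofReal_add (hf0 q hq) (hg0 q hq)]

lemma sum {ι : Type*} (s : Finset ι) {f : ι → ℝ → ℝ} (hf : ∀ i ∈ s, IsLaplace (f i)) :
    IsLaplace fun q => ∑ i ∈ s, f i q := by
  classical
  induction s using Finset.induction_on with
  | empty => simpa using const le_rfl
  | insert i s hi ih =>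
    simp only [Finset.sum_insert hi]
    exact (hf i (Finset.mem_insert_self i s)).add
      (ih fun j hj => hf j (Finset.mem_insert_of_mem hj))

lemma comp_mul_left {f : ℝ → ℝ} (hf : IsLaplace f) (c : ℝ≥0) : IsLaplace fun q => f (c * q) := by
  obtain ⟨hf0, μ, hμ⟩ := hf
  have hc : Measurable fun x : ℝ≥0 => c * x := by fun_prop
  refine ⟨fun q hq => hf0 _ (by positivity), μ.map (fun x => c * x), fun q hq => ?_⟩
  rw [lintegral_map (measurable_ofReal_exp q) hc, ← hμ _ (by positivity)]
  refine lintegral_congr fun x => ?_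
  congr 3
  push_cast
  ring

lemma inv_add {c : ℝ} (hc : 0 < c) : IsLaplace fun q => (q + c)⁻¹ := by
  refine ⟨fun q hq => by positivity,
    ((volume.restrict (Ioi (0 : ℝ))).withDensity
      fun x => ENNReal.ofReal (Real.exp (-(c * x)))).map Real.toNNReal, fun q hq => ?_⟩
  rw [lintegral_map (measurable_ofReal_exp q) measurable_real_toNNReal,
    lintegral_withDensity_eq_lintegral_mul _ (by fun_prop) (by fun_prop)]
  have h : ∀ x ∈ Ioi (0 : ℝ), ((fun x => ENNReal.ofReal (Real.exp (-(c * x)))) * fun x : ℝ =>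
      ENNReal.ofReal (Real.exp (-(q * (x.toNNReal : ℝ))))) x =
      ENNReal.ofReal (Real.exp (-(q + c) * x)) := by
    intro x hx
    rw [Pi.mul_apply, ← ENNReal.ofReal_mul (Real.exp_pos _).le, ← Real.exp_add,
      Real.coe_toNNReal x (le_of_lt hx)]
    congr 2
    ring
  rw [setLIntegral_congr_fun measurableSet_Ioi h]
  have hqc : 0 < q + c := by positivity
  rw [← ofReal_integral_eq_lintegral_ofReal (integrableOn_exp_mul_Ioi (by linarith) 0)
    (ae_of_all _ fun _ => (Real.exp_pos _).le), integral_exp_mul_Ioi (by linarith) 0]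
  congr 1
  rw [mul_zero, Real.exp_zero, neg_div_neg_eq, one_div]

lemma inv_add_sub {f : ℝ → ℝ} (hf : IsLaplace f) {c : ℝ} (hc : 0 < c)
    (h : ∀ q, 0 ≤ q → f q < q + c) : IsLaplace fun q => (q + c - f q)⁻¹ := by
  have key : ∀ q, 0 ≤ q →
      HasSum (fun n : ℕ => (q + c)⁻¹ * (f q * (q + c)⁻¹) ^ n) (q + c - f q)⁻¹ := by
    intro q hq
    have hqc : 0 < q + c := by positivity
    have h1 : f q * (q + c)⁻¹ < 1 := by
      rw [← div_eq_mul_inv, div_lt_one hqc]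
      exact h q hq
    have h0 : 0 ≤ f q * (q + c)⁻¹ := mul_nonneg (hf.1 q hq) (by positivity)
    have hsum := (hasSum_geometric_of_lt_one h0 h1).mul_left (q + c)⁻¹
    rwa [← mul_inv, mul_sub, mul_one, mul_left_comm, mul_inv_cancel₀ hqc.ne', mul_one] at hsum
  refine (tsum (f := fun n q => (q + c)⁻¹ * (f q * (q + c)⁻¹) ^ n)
    (fun n => (inv_add hc).mul ((hf.mul (inv_add hc)).pow n))
    fun q hq => (key q hq).summable).congr fun q hq => (key q hq).tsum_eq

/-- The difference quotient at `0` of the Laplace transform of a measure is the Laplace transform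
of the tail of the measure. -/
lemma exists_antitone {f : ℝ → ℝ} (hf : IsLaplace f) : ∃ h : ℝ → ℝ≥0∞, Antitone h ∧
    ∀ q, 0 < q → ∫⁻ r in Ioi (0 : ℝ), ENNReal.ofReal (Real.exp (-(q * r))) * h r =
      ENNReal.ofReal ((f 0 - f q) / q) := by
  obtain ⟨hf0, ν, hν⟩ := hf
  have := isFiniteMeasure_of_lintegral_exp hν
  refine ⟨fun r => ν {x : ℝ≥0 | r < x}, fun r s hrs => measure_mono fun x hx =>
    lt_of_le_of_lt hrs hx, fun q hq => ?_⟩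
  have hInt : ∀ t : ℝ, ∫ s in (0 : ℝ)..t, q * Real.exp (-(q * s)) = 1 - Real.exp (-(q * t)) := by
    intro t
    rw [intervalIntegral.integral_eq_sub_of_hasDerivAt
      (f := fun s => -Real.exp (-(q * s)))]
    · rw [mul_zero, neg_zero, Real.exp_zero]
      ring
    · intro s _
      have h1 : HasDerivAt (fun s : ℝ => -(q * s)) (-(q * 1)) s :=
        ((hasDerivAt_id s).const_mul q).neg
      refine h1.exp.neg.congr_deriv ?_
      ring
    · exact Continuous.intervalIntegrable (by fun_prop) _ _
  have hlc := lintegral_comp_eq_lintegral_meas_lt_mul ν (f := fun x : ℝ≥0 => (x : ℝ))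
    (g := fun s => q * Real.exp (-(q * s)))
    (ae_of_all _ fun x => x.2) (by fun_prop)
    (fun t _ => Continuous.intervalIntegrable (by fun_prop) _ _)
    (ae_of_all _ fun s => by positivity)
  simp only [hInt] at hlc
  have hsub : ∫⁻ x : ℝ≥0, ENNReal.ofReal (1 - Real.exp (-(q * x))) ∂ν =
      ENNReal.ofReal (f 0 - f q) := by
    rw [ENNReal.ofReal_sub _ (hf0 q hq.le), ← hν 0 le_rfl, ← hν q hq.le, ← lintegral_sub]
    · refine lintegral_congr fun x => ?_
      rw [ENNReal.ofReal_sub _ (Real.exp_pos _).le]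
      simp
    · exact measurable_ofReal_exp q
    · rw [hν q hq.le]
      exact ENNReal.ofReal_ne_top
    · refine ae_of_all _ fun x => ENNReal.ofReal_le_ofReal (Real.exp_le_exp.2 ?_)
      have : 0 ≤ q * x := by positivity
      simpa using this
  rw [ENNReal.ofReal_div_of_pos hq, ← hsub, hlc,
    ENNReal.eq_div_iff (by simpa using hq) ENNReal.ofReal_ne_top,
    ← lintegral_const_mul' _ _ ENNReal.ofReal_ne_top]
  refine lintegral_congr fun r => ?_
  rw [ENNReal.ofReal_mul hq.le]
  ring

end IsLaplace

lemma isLaplace_discreteScale_ratio {ρ : ℝ} (h1 : 1 < ρ) (h2 : ρ < 2) (n : ℕ) :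
    ∀ j ≤ n, IsLaplace fun q => discreteScale ρ q j / discreteScale ρ q n := by
  have hρ : 0 < ρ := by linarith
  have hpos : ∀ n q, 0 ≤ q → 0 < discreteScale ρ q n := fun n q hq => discreteScale_pos hρ hq n
  have hself : ∀ n, IsLaplace fun q => discreteScale ρ q n / discreteScale ρ q n := fun n =>
    (IsLaplace.const zero_le_one).congr fun q hq => (div_self (hpos n q hq).ne').symm
  induction n with
  | zero =>
    intro j hj
    obtain rfl := Nat.le_zero.1 hj
    exact hself 0
  | succ n ih =>
    intro j hj
    rcases hj.eq_or_lt with rfl | hj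
    · exact hself _
    have hf : IsLaplace fun q => ∑ j ∈ Finset.range n,
        negBinomCoeff (-ρ) (n - 1 - j + 2) * (discreteScale ρ q j / discreteScale ρ q n) :=
      IsLaplace.sum _ fun j hj => (IsLaplace.const (negBinomCoeff_neg_nonneg h1 h2 _)).mul
        (ih j (Finset.mem_range.1 hj).le)
    have hratio : ∀ q, 0 ≤ q → discreteScale ρ q (n + 1) / discreteScale ρ q n =
        q + ρ - ∑ j ∈ Finset.range n,
          negBinomCoeff (-ρ) (n - 1 - j + 2) * (discreteScale ρ q j / discreteScale ρ q n) := by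
      intro q hq
      rw [discreteScale_succ, sub_div, mul_div_cancel_right₀ _ (hpos n q hq).ne', Finset.sum_div]
      simp only [mul_div_assoc]
    have hstep := hf.inv_add_sub hρ fun q hq => by
      have := div_pos (hpos (n + 1) q hq) (hpos n q hq)
      rw [hratio q hq] at this
      linarith
    refine ((ih j (Nat.lt_succ_iff.1 hj)).mul hstep).congr fun q hq => ?_
    rw [← hratio q hq, inv_div, div_mul_div_cancel₀ (hpos n q hq).ne']

/-- The Bernstein function `q ↦ W_{n+1}(q) / W_n(q)` is `q + ρ` minus a Laplace transform. -/
lemma exists_isLaplace_discreteScale_succ_div {ρ : ℝ} (h1 : 1 < ρ) (h2 : ρ < 2) (n : ℕ) :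
    ∃ f, IsLaplace f ∧ ∀ q, 0 ≤ q →
      discreteScale ρ q (n + 1) / discreteScale ρ q n = q + ρ - f q := by
  refine ⟨fun q => ∑ j ∈ Finset.range n,
    negBinomCoeff (-ρ) (n - 1 - j + 2) * (discreteScale ρ q j / discreteScale ρ q n),
    IsLaplace.sum _ fun j hj => (IsLaplace.const (negBinomCoeff_neg_nonneg h1 h2 _)).mul
      (isLaplace_discreteScale_ratio h1 h2 n j (Finset.mem_range.1 hj).le), fun q hq => ?_⟩
  have := discreteScale_pos (by linarith : 0 < ρ) hq n
  rw [discreteScale_succ, sub_div, mul_div_cancel_right₀ _ this.ne', Finset.sum_div]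
  simp only [mul_div_assoc]
/-! ### Limits of Laplace transforms of nonincreasing functions -/

/-- **Helly's selection theorem** for antitone functions with values in `[0, ∞]`. -/
lemma exists_subseq_tendsto_of_antitone (h : ℕ → ℝ → ℝ≥0∞) (hh : ∀ n, Antitone (h n)) :
    ∃ g : ℝ → ℝ≥0∞, Antitone g ∧ ∃ φ : ℕ → ℕ, StrictMono φ ∧
      ∀ᵐ r, Tendsto (fun n => h (φ n) r) atTop (𝓝 (g r)) := by
  obtain ⟨u, -, φ, hφ, hu⟩ := (isCompact_univ (X := ℚ → ℝ≥0∞)).tendsto_subseq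
    (x := fun n (x : ℚ) => h n x) fun n => mem_univ _
  have hu' : ∀ x : ℚ, Tendsto (fun n => h (φ n) x) atTop (𝓝 (u x)) := fun x =>
    (tendsto_pi_nhds.1 hu) x
  let g : ℝ → ℝ≥0∞ := fun r => ⨅ x : {x : ℚ // (x : ℝ) < r}, u x
  have hg : Antitone g := fun r s hrs =>
    le_iInf fun x => iInf_le_of_le ⟨x.1, x.2.trans_le hrs⟩ le_rfl
  refine ⟨g, hg, φ, hφ, ?_⟩
  have hcount : ∀ᵐ r, ContinuousAt g r := by
    have := hg.countable_not_continuousAt.measure_zero volume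
    rwa [ae_iff]
  filter_upwards [hcount] with r hr
  refine tendsto_order.2 ⟨fun c hc => ?_, fun c hc => ?_⟩
  · have hlt : ∀ᶠ s in 𝓝 r, c < g s := hr.eventually (lt_mem_nhds hc)
    obtain ⟨s, hrs, hs⟩ := (Filter.nonempty_of_mem
      (inter_mem (mem_nhdsWithin_of_mem_nhds hlt) (self_mem_nhdsWithin (s := Ioi r))))
    obtain ⟨x, hrx, hxs⟩ := exists_rat_btwn (show r < s from hs)
    have hcx : c < u x := lt_of_lt_of_le hrs (iInf_le_of_le ⟨x, hxs⟩ le_rfl)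
    filter_upwards [(hu' x).eventually (lt_mem_nhds hcx)] with n hn
    exact hn.trans_le (hh _ hrx.le)
  · obtain ⟨x, hx⟩ := iInf_lt_iff.1 hc
    filter_upwards [(hu' x.1).eventually (gt_mem_nhds hx)] with n hn
    exact (hh _ x.2.le).trans_lt hn

/-- The Laplace transform, with values in `[0, ∞]`, of a function on `(0, ∞)`. -/
noncomputable def laplaceENN (h : ℝ → ℝ≥0∞) (q : ℝ) : ℝ≥0∞ :=
  ∫⁻ r in Ioi (0 : ℝ), ENNReal.ofReal (Real.exp (-(q * r))) * h r

lemma antitone_mul_le_laplaceENN {h : ℝ → ℝ≥0∞} (hh : Antitone h) {r : ℝ} (hr : 0 < r) :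
    ENNReal.ofReal (min r 1 * Real.exp (-1)) * h r ≤ laplaceENN h 1 := by
  set t := min r 1 with ht
  have ht0 : 0 < t := lt_min hr one_pos
  have ht1 : t ≤ 1 := min_le_right _ _
  calc ENNReal.ofReal (t * Real.exp (-1)) * h r
      = ∫⁻ s in Ioc 0 t, ENNReal.ofReal (Real.exp (-1)) * h r := by
        rw [setLIntegral_const, Real.volume_Ioc, sub_zero, ENNReal.ofReal_mul ht0.le]
        ring
    _ ≤ ∫⁻ s in Ioc 0 t, ENNReal.ofReal (Real.exp (-(1 * s))) * h s := by
        refine setLIntegral_mono' measurableSet_Ioc fun s hs => ?_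
        gcongr
        · linarith [hs.2]
        · exact hh (hs.2.trans (min_le_left _ _))
    _ ≤ laplaceENN h 1 := lintegral_mono_set Ioc_subset_Ioi_self

lemma antitone_le_of_laplaceENN_le {h : ℝ → ℝ≥0∞} (hh : Antitone h) {B : ℝ}
    (hB : laplaceENN h 1 ≤ ENNReal.ofReal B) {r : ℝ} (hr : 0 < r) :
    h r ≤ ENNReal.ofReal (B * Real.exp 1 * (min r 1)⁻¹) := by
  have ht0 : 0 < min r 1 := lt_min hr one_pos
  have h1 := (antitone_mul_le_laplaceENN hh hr).trans hB
  have h0 : 0 < min r 1 * Real.exp (-1) := by positivity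
  have h2 : B * Real.exp 1 * (min r 1)⁻¹ = B / (min r 1 * Real.exp (-1)) := by
    rw [Real.exp_neg]
    field_simp
  rw [h2, ENNReal.ofReal_div_of_pos h0,
    ENNReal.le_div_iff_mul_le (Or.inl (by simpa using h0)) (Or.inl ENNReal.ofReal_ne_top), mul_comm]
  exact h1

lemma laplaceENN_eq_add {h : ℝ → ℝ≥0∞} (hh : Antitone h) {p q : ℝ} (hpq : p ≤ q) :
    laplaceENN h p = laplaceENN h q + ∫⁻ r in Ioi (0 : ℝ),
      ENNReal.ofReal (Real.exp (-(p * r)) - Real.exp (-(q * r))) * h r := by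
  have := hh.measurable
  rw [laplaceENN, laplaceENN, ← lintegral_add_left (by fun_prop)]
  refine setLIntegral_congr_fun measurableSet_Ioi fun r hr => ?_
  have hr : 0 < r := hr
  have h1 : Real.exp (-(q * r)) ≤ Real.exp (-(p * r)) := by gcongr
  rw [← add_mul, ← ENNReal.ofReal_add (Real.exp_pos _).le (by linarith)]
  congr 2
  ring

lemma exp_sub_exp_mul_inv_min_le {p q r : ℝ} (hp : 0 < p) (hpq : p ≤ q) (hr : 0 < r) :
    (Real.exp (-(p * r)) - Real.exp (-(q * r))) * (min r 1)⁻¹ ≤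
      (q - p) * (1 + 2 / p) * Real.exp (-(p / 2) * r) := by
  have hm : 0 < min r 1 := lt_min hr one_pos
  have h1 : Real.exp (-(p * r)) - Real.exp (-(q * r)) ≤ (q - p) * r * Real.exp (-(p * r)) := by
    have h2 : Real.exp (-(q * r)) = Real.exp (-(p * r)) * Real.exp (-((q - p) * r)) := by
      rw [← Real.exp_add]
      congr 1
      ring
    have h3 := Real.add_one_le_exp (-((q - p) * r))
    have h4 := Real.exp_pos (-(p * r))
    rw [h2]
    nlinarith
  have h5 : r * (min r 1)⁻¹ ≤ 1 + r := by
    rw [← div_eq_mul_inv, div_le_iff₀ hm]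
    rcases le_total r 1 with h | h
    · rw [min_eq_left h]; nlinarith
    · rw [min_eq_right h]; linarith
  have h6 : 1 + r ≤ (1 + 2 / p) * Real.exp (p / 2 * r) := by
    have h7 := Real.add_one_le_exp (p / 2 * r)
    have h8 : (1 + 2 / p) * (p / 2 * r + 1) = 1 + r + (p / 2 * r + 2 / p) := by
      field_simp
      ring
    have h9 : 0 < p / 2 * r + 2 / p := by positivity
    have h10 : (1 + 2 / p) * (p / 2 * r + 1) ≤ (1 + 2 / p) * Real.exp (p / 2 * r) := by gcongr
    linarith
  have h11 : Real.exp (-(p / 2) * r) = Real.exp (-(p * r)) * Real.exp (p / 2 * r) := by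
    rw [← Real.exp_add]
    congr 1
    ring
  have hqp : 0 ≤ q - p := by linarith
  calc (Real.exp (-(p * r)) - Real.exp (-(q * r))) * (min r 1)⁻¹
      ≤ (q - p) * r * Real.exp (-(p * r)) * (min r 1)⁻¹ := by gcongr
    _ = (q - p) * Real.exp (-(p * r)) * (r * (min r 1)⁻¹) := by ring
    _ ≤ (q - p) * Real.exp (-(p * r)) * ((1 + 2 / p) * Real.exp (p / 2 * r)) := by
        exact mul_le_mul_of_nonneg_left (h5.trans h6) (by positivity)
    _ = _ := by rw [h11]; ring

/-- A pointwise limit of Laplace transforms of nonincreasing functions is, up to a nonnegative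
additive constant, the Laplace transform of a nonincreasing function. -/
lemma exists_laplaceENN_of_tendsto (h : ℕ → ℝ → ℝ≥0∞) (hh : ∀ n, Antitone (h n)) (Φ : ℝ → ℝ)
    (hΦ : ∀ q, 0 < q → Tendsto (fun n => laplaceENN (h n) q) atTop (𝓝 (ENNReal.ofReal (Φ q)))) :
    ∃ a : ℝ≥0, ∃ g : ℝ → ℝ≥0∞, Antitone g ∧
      ∀ q, 0 < q → ENNReal.ofReal (Φ q) = a + laplaceENN g q := by
  obtain ⟨g, hg, φ, hφ, hlim⟩ := exists_subseq_tendsto_of_antitone h hh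
  have hΦφ : ∀ q, 0 < q → Tendsto (fun n => laplaceENN (h (φ n)) q) atTop
      (𝓝 (ENNReal.ofReal (Φ q))) := fun q hq => (hΦ q hq).comp hφ.tendsto_atTop
  have hmeas : ∀ n, Measurable (h n) := fun n => (hh n).measurable
  have hgmeas := hg.measurable
  have hfatou : ∀ q, 0 < q → laplaceENN g q ≤ ENNReal.ofReal (Φ q) := by
    intro q hq
    have hl : laplaceENN g q = ∫⁻ r in Ioi (0 : ℝ), liminf (fun n =>
        ENNReal.ofReal (Real.exp (-(q * r))) * h (φ n) r) atTop := by
      refine lintegral_congr_ae ?_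
      filter_upwards [ae_restrict_of_ae hlim] with r hr
      exact (ENNReal.Tendsto.const_mul hr (Or.inr ENNReal.ofReal_ne_top)).liminf_eq.symm
    rw [hl, ← (hΦφ q hq).liminf_eq]
    exact lintegral_liminf_le' fun n => by
      have := hmeas (φ n)
      fun_prop
  have hdiff : ∀ p q, 0 < p → p ≤ q → ENNReal.ofReal (Φ p) = ENNReal.ofReal (Φ q) +
      ∫⁻ r in Ioi (0 : ℝ), ENNReal.ofReal (Real.exp (-(p * r)) - Real.exp (-(q * r))) * g r := by
    intro p q hp hpq
    obtain ⟨B, hB0, hB⟩ : ∃ B : ℝ, 0 ≤ B ∧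
        ∀ᶠ n in atTop, laplaceENN (h (φ n)) 1 ≤ ENNReal.ofReal B := by
      refine ⟨|Φ 1| + 1, by positivity, ?_⟩
      have h1 : ENNReal.ofReal (Φ 1) < ENNReal.ofReal (|Φ 1| + 1) :=
        (ENNReal.ofReal_lt_ofReal_iff (by positivity)).2 (by linarith [le_abs_self (Φ 1)])
      filter_upwards [(hΦφ 1 one_pos).eventually (gt_mem_nhds h1)] with n hn using hn.le
    have hdct : Tendsto (fun n => ∫⁻ r in Ioi (0 : ℝ),
        ENNReal.ofReal (Real.exp (-(p * r)) - Real.exp (-(q * r))) * h (φ n) r) atTop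
        (𝓝 (∫⁻ r in Ioi (0 : ℝ),
          ENNReal.ofReal (Real.exp (-(p * r)) - Real.exp (-(q * r))) * g r)) := by
      refine tendsto_lintegral_filter_of_dominated_convergence
        (fun r => ENNReal.ofReal (B * Real.exp 1 * ((q - p) * (1 + 2 / p)) *
          Real.exp (-(p / 2) * r))) ?_ ?_ ?_ ?_
      · exact Eventually.of_forall fun n => by
          have := hmeas (φ n)
          fun_prop
      · filter_upwards [hB] with n hn
        filter_upwards [ae_restrict_mem measurableSet_Ioi] with r hr
        have hr : 0 < r := hr
        have h1 : 0 ≤ Real.exp (-(p * r)) - Real.exp (-(q * r)) := by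
          rw [sub_nonneg]
          gcongr
        calc _ ≤ ENNReal.ofReal (Real.exp (-(p * r)) - Real.exp (-(q * r))) *
              ENNReal.ofReal (B * Real.exp 1 * (min r 1)⁻¹) := by
              gcongr
              exact antitone_le_of_laplaceENN_le (hh _) hn hr
          _ = ENNReal.ofReal (B * Real.exp 1 *
              ((Real.exp (-(p * r)) - Real.exp (-(q * r))) * (min r 1)⁻¹)) := by
              rw [← ENNReal.ofReal_mul h1]
              congr 1
              ring
          _ ≤ _ := by
              refine ENNReal.ofReal_le_ofReal ?_
              rw [mul_assoc (B * Real.exp 1)]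
              exact mul_le_mul_of_nonneg_left (exp_sub_exp_mul_inv_min_le hp hpq hr)
                (by positivity)
      · have hi : IntegrableOn (fun r => B * Real.exp 1 * ((q - p) * (1 + 2 / p)) *
            Real.exp (-(p / 2) * r)) (Ioi 0) :=
          (integrableOn_exp_mul_Ioi (by linarith) 0).const_mul _
        exact hi.lintegral_lt_top.ne
      · filter_upwards [ae_restrict_of_ae hlim] with r hr
        exact ENNReal.Tendsto.const_mul hr (Or.inr ENNReal.ofReal_ne_top)
    refine tendsto_nhds_unique (hΦφ p hp) ?_
    simp only [laplaceENN_eq_add (hh _) hpq]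
    exact (hΦφ q (hp.trans_le hpq)).add hdct
  have hfin : ∀ q, 0 < q → laplaceENN g q ≠ ∞ := fun q hq =>
    ((hfatou q hq).trans_lt ENNReal.ofReal_lt_top).ne
  have hconst : ∀ p q, 0 < p → p ≤ q →
      ENNReal.ofReal (Φ p) - laplaceENN g p = ENNReal.ofReal (Φ q) - laplaceENN g q := by
    intro p q hp hpq
    have h1 := hfin p hp
    rw [laplaceENN_eq_add hg hpq] at h1
    rw [hdiff p q hp hpq, laplaceENN_eq_add hg hpq]
    rw [tsub_add_eq_tsub_tsub_swap, ENNReal.add_sub_cancel_right (ENNReal.add_ne_top.1 h1).2]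
  refine ⟨(ENNReal.ofReal (Φ 1) - laplaceENN g 1).toNNReal, g, hg, fun q hq => ?_⟩
  rw [ENNReal.coe_toNNReal (ENNReal.sub_ne_top ENNReal.ofReal_ne_top)]
  have h1 : ENNReal.ofReal (Φ 1) - laplaceENN g 1 = ENNReal.ofReal (Φ q) - laplaceENN g q := by
    rcases le_total q 1 with h | h
    · exact (hconst q 1 hq h).symm
    · exact hconst 1 q one_pos h
  rw [h1, tsub_add_cancel_of_le (hfatou q hq)]
/-! ### Gamma function asymptotics -/

lemma Gamma_add_le_mul_rpow {x β : ℝ} (hx : 0 ≤ x) (hβ : 1 < β) :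
    Real.Gamma (x + β) ≤ Real.Gamma (x + 1) * (x + β) ^ (β - 1) := by
  have h1 : 0 < x + 1 := by linarith
  have h2 : 0 < x + β := by linarith
  have hΓ1 := Real.Gamma_pos_of_pos h1
  have hΓ2 := Real.Gamma_pos_of_pos h2
  have h := Real.convexOn_log_Gamma.slope_mono_adjacent (x := x + 1) (y := x + β)
    (z := x + β + 1) h1 (by simp only [mem_Ioi]; linarith) (by linarith) (by linarith)
  simp only [Function.comp_apply] at h
  rw [Real.Gamma_add_one h2.ne', Real.log_mul h2.ne' hΓ2.ne', div_le_div_iff₀ (by linarith)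
    (by linarith)] at h
  rw [← Real.log_le_log_iff hΓ2 (by positivity), Real.log_mul hΓ1.ne' (by positivity),
    Real.log_rpow h2]
  linarith

lemma mul_rpow_le_Gamma_add {x β : ℝ} (hx : 0 < x) (hβ : 1 < β) :
    Real.Gamma (x + 1) * x ^ (β - 1) ≤ Real.Gamma (x + β) := by
  have h1 : 0 < x + 1 := by linarith
  have h2 : 0 < x + β := by linarith
  have hΓ := Real.Gamma_pos_of_pos hx
  have hΓ1 := Real.Gamma_pos_of_pos h1
  have hΓ2 := Real.Gamma_pos_of_pos h2
  have h := Real.convexOn_log_Gamma.slope_mono_adjacent (x := x) (y := x + 1)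
    (z := x + β) hx h2 (by linarith) (by linarith)
  simp only [Function.comp_apply] at h
  rw [div_le_div_iff₀ (by linarith) (by linarith)] at h
  rw [← Real.log_le_log_iff (by positivity) hΓ2, Real.log_mul hΓ1.ne' (by positivity),
    Real.log_rpow hx]
  have h3 : Real.log (Real.Gamma (x + 1)) = Real.log x + Real.log (Real.Gamma x) := by
    rw [Real.Gamma_add_one hx.ne', Real.log_mul hx.ne' hΓ.ne']
  rw [h3] at h ⊢
  linarith

lemma tendsto_add_div_add (a b : ℝ) :
    Tendsto (fun j : ℕ => ((j : ℝ) + a) / (j + b)) atTop (𝓝 1) := by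
  have h1 : Tendsto (fun j : ℕ => (j : ℝ) + b) atTop atTop :=
    tendsto_atTop_add_const_right _ _ tendsto_natCast_atTop_atTop
  have h2 := (h1.const_div_atTop (a - b)).const_add 1
  rw [add_zero] at h2
  refine h2.congr' ?_
  filter_upwards [h1.eventually_gt_atTop 0] with j hj
  field_simp
  ring

lemma tendsto_negBinomCoeff_div_rpow {β : ℝ} (hβ : 1 < β) (m : ℕ) :
    Tendsto (fun n : ℕ => negBinomCoeff β (n - m) / (n : ℝ) ^ (β - 1)) atTop
      (𝓝 (1 / Real.Gamma β)) := by
  rw [← tendsto_add_atTop_iff_nat m]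
  have hΓ := Real.Gamma_pos_of_pos (show 0 < β by linarith)
  have hpow : ∀ a : ℝ, Tendsto (fun j : ℕ => (1 / Real.Gamma β) *
      (((j : ℝ) + a) / (j + m)) ^ (β - 1)) atTop (𝓝 (1 / Real.Gamma β)) := by
    intro a
    have := ((tendsto_add_div_add a m).rpow_const (p := β - 1) (Or.inl one_ne_zero)).const_mul
      (1 / Real.Gamma β)
    rwa [Real.one_rpow, mul_one] at this
  refine tendsto_of_tendsto_of_tendsto_of_le_of_le' (hpow 0) (hpow β) ?_ ?_
  · filter_upwards [eventually_gt_atTop 0] with j hj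
    have hj' : (0 : ℝ) < j := by exact_mod_cast hj
    have h := mul_rpow_le_Gamma_add hj' hβ
    have hΓ1 := Real.Gamma_pos_of_pos (show (0 : ℝ) < j + 1 by positivity)
    rw [Nat.add_sub_cancel, negBinomCoeff_eq_Gamma (by linarith), add_zero,
      Real.div_rpow hj'.le (by positivity), Nat.cast_add, ← mul_div_assoc]
    gcongr
    rw [one_div_mul_eq_div, div_le_div_iff₀ hΓ (by positivity)]
    nlinarith
  · refine Eventually.of_forall fun j => ?_
    have hj' : (0 : ℝ) ≤ j := j.cast_nonneg
    have h := Gamma_add_le_mul_rpow hj' hβ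
    have hΓ1 := Real.Gamma_pos_of_pos (show (0 : ℝ) < j + 1 by positivity)
    rw [Nat.add_sub_cancel, negBinomCoeff_eq_Gamma (by linarith),
      Real.div_rpow (by linarith) (by positivity), Nat.cast_add, ← mul_div_assoc]
    gcongr
    rw [one_div_mul_eq_div, div_le_div_iff₀ (by positivity) hΓ]
    nlinarith

lemma negBinomCoeff_div_rpow_le {ρ : ℝ} (h1 : 1 < ρ) (h2 : ρ < 2) {m n : ℕ} (hn : 0 < n)
    (hmn : m ≤ n) : negBinomCoeff (ρ * m + ρ) (n - m) / (n : ℝ) ^ (ρ * m + ρ - 1) ≤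
      16 ^ (m + 1) / Real.Gamma (ρ * m + ρ) := by
  have hm : (0 : ℝ) ≤ m := m.cast_nonneg
  have hβ : 1 < ρ * m + ρ := by nlinarith
  have hn' : (1 : ℝ) ≤ n := by exact_mod_cast hn
  have hmn' : (m : ℝ) ≤ n := by exact_mod_cast hmn
  have hΓ := Real.Gamma_pos_of_pos (show 0 < ρ * m + ρ by linarith)
  have hj : (0 : ℝ) ≤ ((n - m : ℕ) : ℝ) := Nat.cast_nonneg _
  have hΓ1 := Real.Gamma_pos_of_pos (show (0 : ℝ) < ((n - m : ℕ) : ℝ) + 1 by positivity)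
  have h := Gamma_add_le_mul_rpow hj hβ
  have hle : ((n - m : ℕ) : ℝ) + (ρ * m + ρ) ≤ 4 * n := by
    rw [Nat.cast_sub hmn]
    nlinarith
  have h16 : (4 : ℝ) ^ (ρ * m + ρ - 1) ≤ 16 ^ (m + 1) := by
    calc (4 : ℝ) ^ (ρ * m + ρ - 1) ≤ 4 ^ ((2 * (m + 1) : ℕ) : ℝ) := by
          apply Real.rpow_le_rpow_of_exponent_le (by norm_num)
          push_cast
          nlinarith
      _ = 16 ^ (m + 1) := by
          rw [Real.rpow_natCast, pow_mul]
          norm_num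
  have hpow : (((n - m : ℕ) : ℝ) + (ρ * m + ρ)) ^ (ρ * m + ρ - 1) ≤
      16 ^ (m + 1) * (n : ℝ) ^ (ρ * m + ρ - 1) := by
    calc _ ≤ (4 * (n : ℝ)) ^ (ρ * m + ρ - 1) :=
          Real.rpow_le_rpow (by positivity) hle (by linarith)
      _ = 4 ^ (ρ * m + ρ - 1) * (n : ℝ) ^ (ρ * m + ρ - 1) :=
          Real.mul_rpow (by norm_num) (by positivity)
      _ ≤ _ := by gcongr
  rw [negBinomCoeff_eq_Gamma (by linarith), div_div, div_le_div_iff₀ (by positivity) hΓ]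
  calc _ ≤ Real.Gamma (((n - m : ℕ) : ℝ) + 1) *
        (16 ^ (m + 1) * (n : ℝ) ^ (ρ * m + ρ - 1)) * Real.Gamma (ρ * m + ρ) := by
        gcongr
        exact h.trans (by gcongr)
    _ = _ := by ring

/-! ### The Mittag-Leffler function and its derivative -/

lemma summable_pow_div_Gamma {ρ : ℝ} (h1 : 1 < ρ) (x : ℝ) :
    Summable fun m : ℕ => x ^ m / Real.Gamma (ρ * m + ρ) := by
  rw [← summable_nat_add_iff 1]
  have hs := (summable_nat_add_iff 1).2 (Real.summable_pow_div_factorial |x|)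
  refine Summable.of_norm_bounded hs fun m => ?_
  have hm : (0 : ℝ) ≤ m := m.cast_nonneg
  have hΓ : ((m + 1).factorial : ℝ) ≤ Real.Gamma (ρ * (m + 1 : ℕ) + ρ) := by
    rw [← Real.Gamma_nat_eq_factorial]
    refine Real.Gamma_strictMonoOn_Ici.monotoneOn (mem_Ici.2 ?_) (mem_Ici.2 ?_) ?_ <;>
      push_cast <;> nlinarith
  have hf : (0 : ℝ) < ((m + 1).factorial : ℝ) := by positivity
  rw [norm_div, norm_pow, Real.norm_eq_abs, Real.norm_eq_abs, abs_of_pos (hf.trans_le hΓ)]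
  gcongr

lemma mittagLeffler_pos {ρ q : ℝ} (h1 : 1 < ρ) (hq : 0 ≤ q) : 0 < mittagLeffler ρ ρ q := by
  have hΓ : ∀ m : ℕ, 0 < Real.Gamma (ρ * m + ρ) := fun m => Real.Gamma_pos_of_pos (by positivity)
  refine (summable_pow_div_Gamma h1 q).tsum_pos (fun m => ?_) 0 ?_
  · have := hΓ m
    positivity
  · have := hΓ 0
    positivity

/-- The termwise derivative of `mittagLeffler ρ ρ`. -/
noncomputable def mittagLefflerDeriv (ρ x : ℝ) : ℝ :=
  ∑' n : ℕ, (n * x ^ (n - 1)) / Real.Gamma (ρ * n + ρ)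

lemma natCast_add_one_le_two_pow (m : ℕ) : (m : ℝ) + 1 ≤ 2 ^ m := by
  exact_mod_cast Nat.lt_two_pow_self (n := m)

lemma norm_mittagLefflerDeriv_term_le {ρ x R : ℝ} (h1 : 1 < ρ) (hR : 1 ≤ R) (hx : |x| ≤ R) (n : ℕ) :
    ‖(n * x ^ (n - 1)) / Real.Gamma (ρ * n + ρ)‖ ≤ (2 * R) ^ n / Real.Gamma (ρ * n + ρ) := by
  have hΓ : 0 < Real.Gamma (ρ * n + ρ) := Real.Gamma_pos_of_pos (by positivity)
  rw [norm_div, norm_mul, norm_pow, Real.norm_eq_abs, Real.norm_eq_abs, Real.norm_eq_abs,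
    abs_of_pos hΓ, Nat.abs_cast, mul_pow]
  gcongr
  · linarith [natCast_add_one_le_two_pow n]
  · exact (pow_le_pow_left₀ (abs_nonneg _) hx _).trans (pow_le_pow_right₀ hR (Nat.sub_le _ _))

lemma hasDerivAt_mittagLeffler {ρ : ℝ} (h1 : 1 < ρ) (x : ℝ) :
    HasDerivAt (mittagLeffler ρ ρ) (mittagLefflerDeriv ρ x) x := by
  have h0 : (0 : ℝ) ∈ Metric.ball (0 : ℝ) (|x| + 1) := by
    simpa using (abs_nonneg x).trans_lt (lt_add_one _)
  have hx : x ∈ Metric.ball (0 : ℝ) (|x| + 1) := by simp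
  exact hasDerivAt_tsum_of_isPreconnected (g := fun (n : ℕ) x => x ^ n / Real.Gamma (ρ * n + ρ))
    (g' := fun (n : ℕ) x => (n * x ^ (n - 1)) / Real.Gamma (ρ * n + ρ))
    (summable_pow_div_Gamma h1 (2 * (|x| + 1)))
    Metric.isOpen_ball (convex_ball _ _).isPreconnected
    (fun n y _ => (hasDerivAt_pow n y).div_const _)
    (fun n y hy => norm_mittagLefflerDeriv_term_le h1 (by linarith [abs_nonneg x])
      (mem_ball_zero_iff.1 hy).le n) h0 (summable_pow_div_Gamma h1 0) hx

lemma continuous_mittagLefflerDeriv {ρ : ℝ} (h1 : 1 < ρ) : Continuous (mittagLefflerDeriv ρ) := by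
  rw [continuous_iff_continuousAt]
  intro x
  have hc : ContinuousOn (mittagLefflerDeriv ρ) (Metric.ball 0 (|x| + 1)) :=
    continuousOn_tsum (fun n => by fun_prop) (summable_pow_div_Gamma h1 (2 * (|x| + 1)))
      fun n y hy => norm_mittagLefflerDeriv_term_le h1 (by linarith [abs_nonneg x])
        (mem_ball_zero_iff.1 hy).le n
  exact hc.continuousAt (Metric.isOpen_ball.mem_nhds (by simp))

lemma tsum_mul_eq_mittagLeffler {ρ : ℝ} (h1 : 1 < ρ) (q : ℝ) :
    ∑' m : ℕ, q ^ m * (ρ * m + ρ - 1) / Real.Gamma (ρ * m + ρ) =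
      (ρ - 1) * mittagLeffler ρ ρ q + ρ * q * mittagLefflerDeriv ρ q := by
  have hs : Summable fun n : ℕ => (n * q ^ (n - 1)) / Real.Gamma (ρ * n + ρ) :=
    Summable.of_norm_bounded (summable_pow_div_Gamma h1 (2 * (|q| + 1)))
      fun n => norm_mittagLefflerDeriv_term_le h1 (by linarith [abs_nonneg q])
        (by linarith) n
  rw [mittagLeffler, mittagLefflerDeriv, ← tsum_mul_left, ← tsum_mul_left,
    ← Summable.tsum_add ((summable_pow_div_Gamma h1 q).mul_left _) (hs.mul_left _)]
  refine tsum_congr fun m => ?_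
  cases m with
  | zero => simp; ring
  | succ m =>
    rw [Nat.add_sub_cancel, pow_succ]
    ring

/-! ### Scaling limits -/

lemma tendsto_sum_weighted_div_rpow {ρ q C : ℝ} (h1 : 1 < ρ) (h2 : ρ < 2) (hq : 0 ≤ q)
    {w : ℕ → ℕ → ℝ} {v : ℕ → ℝ} (hw : ∀ n m, m ≤ n → |w n m| ≤ C * 4 ^ m)
    (hv : ∀ m, Tendsto (fun n => w n m) atTop (𝓝 (v m))) :
    Tendsto (fun n : ℕ => (∑ m ∈ Finset.range (n + 1), (q * (n : ℝ) ^ (-ρ)) ^ m *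
      negBinomCoeff (ρ * (m + 1)) (n - m) * w n m) / (n : ℝ) ^ (ρ - 1)) atTop
      (𝓝 (∑' m : ℕ, q ^ m * v m / Real.Gamma (ρ * m + ρ))) := by
  set F : ℕ → ℕ → ℝ := fun n m => if m ≤ n then
    q ^ m * (negBinomCoeff (ρ * m + ρ) (n - m) / (n : ℝ) ^ (ρ * m + ρ - 1)) * w n m else 0 with hF
  have hβ : ∀ m : ℕ, 1 < ρ * m + ρ := fun m => by
    have : (0 : ℝ) ≤ ρ * m := by positivity
    linarith
  have hlim : Tendsto (fun n => ∑' m, F n m) atTop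
      (𝓝 (∑' m : ℕ, q ^ m * v m / Real.Gamma (ρ * m + ρ))) := by
    refine tendsto_tsum_of_dominated_convergence
      ((summable_pow_div_Gamma h1 (64 * q)).mul_left (16 * C)) (fun m => ?_) ?_
    · have h := ((tendsto_negBinomCoeff_div_rpow (hβ m) m).const_mul (q ^ m)).mul (hv m)
      rw [mul_one_div, div_mul_eq_mul_div] at h
      refine h.congr' ?_
      filter_upwards [eventually_ge_atTop m] with n hn
      simp only [hF, if_pos hn]
    · filter_upwards [eventually_gt_atTop 0] with n hn m
      have hΓ := Real.Gamma_pos_of_pos (zero_lt_one.trans (hβ m))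
      by_cases hmn : m ≤ n
      · have hb := negBinomCoeff_pos (zero_lt_one.trans (hβ m)) (n - m)
        have hle := negBinomCoeff_div_rpow_le h1 h2 hn hmn
        simp only [hF, if_pos hmn]
        rw [norm_mul, Real.norm_of_nonneg (by positivity), Real.norm_eq_abs]
        calc _ ≤ q ^ m * (16 ^ (m + 1) / Real.Gamma (ρ * m + ρ)) * (C * 4 ^ m) := by
              gcongr
              exact hw n m hmn
          _ = 16 * C * ((64 * q) ^ m / Real.Gamma (ρ * m + ρ)) := by
              rw [show (64 : ℝ) * q = 16 * q * 4 by ring, mul_pow, mul_pow]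
              ring
      · have hC : 0 ≤ C := by simpa using (abs_nonneg _).trans (hw 0 0 le_rfl)
        simp only [hF, if_neg hmn, norm_zero]
        positivity
  refine hlim.congr' ?_
  filter_upwards [eventually_gt_atTop 0] with n hn
  have hn' : (0 : ℝ) < n := by exact_mod_cast hn
  rw [tsum_eq_sum (s := Finset.range (n + 1)) fun m hm => if_neg (by simpa using hm),
    Finset.sum_div]
  refine Finset.sum_congr rfl fun m hm => ?_
  have hmn : m ≤ n := Nat.lt_succ_iff.1 (Finset.mem_range.1 hm)
  have hpow : (n : ℝ) ^ (ρ * m + ρ - 1) = ((n : ℝ) ^ (-ρ))⁻¹ ^ m * (n : ℝ) ^ (ρ - 1) := by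
    rw [Real.rpow_neg hn'.le, inv_inv, ← Real.rpow_mul_natCast hn'.le, ← Real.rpow_add hn']
    ring_nf
  rw [if_pos hmn, hpow, mul_pow, inv_pow, mul_add_one]
  field_simp

lemma tendsto_discreteScale_div_rpow {ρ q : ℝ} (h1 : 1 < ρ) (h2 : ρ < 2) (hq : 0 ≤ q) :
    Tendsto (fun n : ℕ => discreteScale ρ (q * (n : ℝ) ^ (-ρ)) n / (n : ℝ) ^ (ρ - 1)) atTop
      (𝓝 (mittagLeffler ρ ρ q)) := by
  have h := tendsto_sum_weighted_div_rpow (C := 1) (w := fun _ _ => 1) (v := fun _ => 1) h1 h2 hq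
    (fun n m _ => by simpa using one_le_pow₀ (by norm_num : (1 : ℝ) ≤ 4))
    fun m => tendsto_const_nhds
  simpa only [mul_one, discreteScale, mittagLeffler] using h

lemma discreteScale_succ_sub (ρ s : ℝ) (n : ℕ) :
    discreteScale ρ s (n + 1) - discreteScale ρ s n = (∑ m ∈ Finset.range (n + 1),
      s ^ m * negBinomCoeff (ρ * (m + 1)) (n - m) *
        ((ρ * (m + 1) - 1) / ((n - m : ℕ) + 1))) + s ^ (n + 1) := by
  rw [discreteScale, Finset.sum_range_succ, discreteScale, Nat.sub_self, negBinomCoeff, mul_one,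
    add_sub_right_comm, ← Finset.sum_sub_distrib]
  congr 1
  refine Finset.sum_congr rfl fun m hm => ?_
  have hmn : m ≤ n := Nat.lt_succ_iff.1 (Finset.mem_range.1 hm)
  rw [Nat.succ_sub hmn, Nat.succ_eq_add_one, negBinomCoeff_succ]
  field_simp
  ring

lemma tendsto_mul_pow_div_rpow {ρ q : ℝ} (h1 : 1 < ρ) (hq : 0 ≤ q) :
    Tendsto (fun n : ℕ => n * (q * (n : ℝ) ^ (-ρ)) ^ (n + 1) / (n : ℝ) ^ (ρ - 1)) atTop (𝓝 0) := by
  have hgeo : Tendsto (fun n : ℕ => q * (1 / 2 : ℝ) ^ n) atTop (𝓝 0) := by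
    simpa using (tendsto_pow_atTop_nhds_zero_of_lt_one (by norm_num : (0 : ℝ) ≤ 1 / 2)
      (by norm_num)).const_mul q
  refine squeeze_zero' (Eventually.of_forall fun n => by positivity) ?_ hgeo
  filter_upwards [tendsto_natCast_atTop_atTop.eventually_ge_atTop (2 * q),
    eventually_gt_atTop 0] with n hn hn0
  have hn' : (1 : ℝ) ≤ n := by exact_mod_cast hn0
  have hs : (n : ℝ) ^ (-ρ) ≤ (n : ℝ)⁻¹ := by
    rw [← Real.rpow_neg_one]
    exact Real.rpow_le_rpow_of_exponent_le hn' (by linarith)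
  have hle : q * (n : ℝ) ^ (-ρ) ≤ q / n := by
    rw [div_eq_mul_inv]
    gcongr
  have hhalf : q / n ≤ 1 / 2 := by
    rw [div_le_div_iff₀ (by positivity) (by norm_num)]
    linarith
  calc _ ≤ n * (q * (n : ℝ) ^ (-ρ)) ^ (n + 1) :=
        div_le_self (by positivity) (Real.one_le_rpow hn' (by linarith))
    _ = n * (q * (n : ℝ) ^ (-ρ)) * (q * (n : ℝ) ^ (-ρ)) ^ n := by ring
    _ ≤ n * (q / n) * (1 / 2) ^ n := by
        gcongr
        exact hle.trans hhalf
    _ = _ := by field_simp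

lemma tendsto_mul_discreteScale_div_sub_one {ρ q : ℝ} (h1 : 1 < ρ) (h2 : ρ < 2) (hq : 0 ≤ q) :
    Tendsto (fun n : ℕ => n * (discreteScale ρ (q * (n : ℝ) ^ (-ρ)) (n + 1) /
      discreteScale ρ (q * (n : ℝ) ^ (-ρ)) n - 1)) atTop
      (𝓝 (ρ - 1 + ρ * (q * (mittagLefflerDeriv ρ q / mittagLeffler ρ ρ q)))) := by
  have hE := mittagLeffler_pos h1 hq
  have hw := tendsto_sum_weighted_div_rpow (C := 2)
    (w := fun n m => (ρ * (m + 1) - 1) * (n / ((n - m : ℕ) + 1))) (v := fun m => ρ * m + ρ - 1)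
    h1 h2 hq (fun n m hmn => ?_) fun m => ?_
  · rw [tsum_mul_eq_mittagLeffler h1] at hw
    have h := (hw.add (tendsto_mul_pow_div_rpow h1 hq)).div
      (tendsto_discreteScale_div_rpow h1 h2 hq) hE.ne'
    have hval : ((ρ - 1) * mittagLeffler ρ ρ q + ρ * q * mittagLefflerDeriv ρ q + 0) /
        mittagLeffler ρ ρ q =
        ρ - 1 + ρ * (q * (mittagLefflerDeriv ρ q / mittagLeffler ρ ρ q)) := by
      field_simp
      ring
    rw [hval] at h
    refine h.congr' ?_
    filter_upwards [eventually_gt_atTop 0] with n hn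
    have hn' : (0 : ℝ) < n := by exact_mod_cast hn
    have hW := discreteScale_pos (zero_lt_one.trans h1)
      (show 0 ≤ q * (n : ℝ) ^ (-ρ) by positivity) n
    have hd := discreteScale_succ_sub ρ (q * (n : ℝ) ^ (-ρ)) n
    rw [Pi.div_apply, ← add_div, div_div_div_cancel_right₀ (by positivity),
      div_sub_one hW.ne', hd, mul_div_assoc', mul_add, Finset.mul_sum]
    congr 2
    refine Finset.sum_congr rfl fun m _ => ?_
    ring
  · have hm : (m : ℝ) + 1 ≤ 2 ^ m := natCast_add_one_le_two_pow m
    have hm0 : (0 : ℝ) ≤ m := m.cast_nonneg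
    have hfrac : (n : ℝ) / ((n - m : ℕ) + 1) ≤ 2 ^ m := by
      refine le_trans ?_ hm
      rw [div_le_iff₀ (by positivity), Nat.cast_sub hmn]
      have : (m : ℝ) ≤ n := by exact_mod_cast hmn
      nlinarith
    have hpos : 0 ≤ ρ * (m + 1) - 1 := by nlinarith
    rw [abs_of_nonneg (by positivity), show (4 : ℝ) = 2 * 2 by norm_num, mul_pow, ← mul_assoc]
    gcongr
    nlinarith
  · have h := (tendsto_add_div_add m 1).const_mul (ρ * m + ρ - 1)
    rw [mul_one] at h
    rw [← tendsto_add_atTop_iff_nat m]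
    refine h.congr fun j => ?_
    rw [Nat.add_sub_cancel]
    push_cast
    ring

/-! ### The logarithmic derivative of the Mittag-Leffler function -/

lemma exists_antitone_tendsto_laplaceENN {ρ : ℝ} (h1 : 1 < ρ) (h2 : ρ < 2) :
    ∃ h : ℕ → ℝ → ℝ≥0∞, (∀ n, Antitone (h n)) ∧ ∀ q, 0 < q →
      Tendsto (fun n => laplaceENN (h n) q) atTop
        (𝓝 (ENNReal.ofReal (mittagLefflerDeriv ρ q / mittagLeffler ρ ρ q))) := by
  have hρ : 0 < ρ := by linarith
  choose f hf hfW using exists_isLaplace_discreteScale_succ_div h1 h2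
  have hF : ∀ n : ℕ, IsLaplace fun q => n / ρ * f n (((n : ℝ≥0) ^ (-ρ) : ℝ≥0) * q) := fun n =>
    (IsLaplace.const (by positivity)).mul ((hf n).comp_mul_left _)
  choose h hh hlap using fun n => (hF n).exists_antitone
  refine ⟨h, hh, fun q hq => ?_⟩
  simp only [laplaceENN, hlap _ q hq]
  refine ENNReal.tendsto_ofReal ?_
  have hzero : Tendsto (fun n : ℕ => (n : ℝ) ^ (1 - ρ)) atTop (𝓝 0) := by
    have := (tendsto_rpow_neg_atTop (sub_pos.2 h1)).comp tendsto_natCast_atTop_atTop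
    simpa only [neg_sub, Function.comp_def] using this
  have hlim := (((tendsto_mul_discreteScale_div_sub_one h1 h2 hq.le).sub
    (tendsto_mul_discreteScale_div_sub_one h1 h2 le_rfl)).div_const (ρ * q)).sub
    (hzero.div_const ρ)
  have hval : (ρ - 1 + ρ * (q * (mittagLefflerDeriv ρ q / mittagLeffler ρ ρ q)) -
      (ρ - 1 + ρ * (0 * (mittagLefflerDeriv ρ 0 / mittagLeffler ρ ρ 0)))) / (ρ * q) - 0 / ρ =
      mittagLefflerDeriv ρ q / mittagLeffler ρ ρ q := by
    rw [zero_mul, mul_zero, add_zero, add_sub_cancel_left, zero_div, sub_zero, ← mul_assoc,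
      mul_div_cancel_left₀ _ (by positivity)]
  rw [hval] at hlim
  refine hlim.congr' ?_
  filter_upwards [eventually_gt_atTop 0] with n hn
  have hn' : (0 : ℝ) < n := by exact_mod_cast hn
  have hpow : (n : ℝ) ^ (1 - ρ) = n * (n : ℝ) ^ (-ρ) := by
    rw [sub_eq_add_neg, Real.rpow_add hn', Real.rpow_one]
  have hcast : (((n : ℝ≥0) ^ (-ρ) : ℝ≥0) : ℝ) = (n : ℝ) ^ (-ρ) := by simp
  rw [hcast, mul_zero, hfW n _ (by positivity), hfW n _ (by positivity), zero_mul, mul_comm q, hpow]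
  field_simp
  ring

lemma integral_exp_neg_mul {r : ℝ} (hr : r ≠ 0) (q : ℝ) :
    ∫ s in (0 : ℝ)..q, Real.exp (-(s * r)) = (1 - Real.exp (-q * r)) / r := by
  have hd : ∀ s ∈ uIcc 0 q, HasDerivAt (fun s => -Real.exp (-(s * r)) / r)
      (Real.exp (-(s * r))) s := fun s _ => by
    refine ((((hasDerivAt_id s).mul_const r).neg.exp.neg).div_const r).congr_deriv ?_
    simp only [Pi.neg_apply, id_eq]
    field_simp
  rw [intervalIntegral.integral_eq_sub_of_hasDerivAt hd
    ((by fun_prop : Continuous fun s => Real.exp (-(s * r))).intervalIntegrable _ _)]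
  simp only [zero_mul, neg_zero, Real.exp_zero, neg_mul]
  ring

lemma lintegral_laplaceENN {g : ℝ → ℝ≥0∞} (hg : Antitone g) {q : ℝ} (hq : 0 ≤ q) :
    ∫⁻ s in Ioc 0 q, laplaceENN g s =
      ∫⁻ r in Ioi 0, ENNReal.ofReal ((1 - Real.exp (-q * r)) / r) * g r := by
  have hgm := hg.measurable
  simp only [laplaceENN]
  rw [lintegral_lintegral_swap (by
    refine Measurable.aemeasurable ?_
    simp only [Function.uncurry_def]
    fun_prop)]
  refine setLIntegral_congr_fun measurableSet_Ioi fun r hr => ?_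
  have hc : Continuous fun s => Real.exp (-(s * r)) := by fun_prop
  rw [lintegral_mul_const _ (by fun_prop), ← integral_exp_neg_mul (ne_of_gt hr),
    intervalIntegral.integral_of_le hq, ofReal_integral_eq_lintegral_ofReal
      (hc.intervalIntegrable 0 q).1 (Eventually.of_forall fun s => (Real.exp_pos _).le)]

lemma min_one_le_two_mul_one_sub_exp {r : ℝ} (hr : 0 < r) :
    min 1 r ≤ 2 * (1 - Real.exp (-r)) := by
  have hexp : Real.exp (-r) ≤ 1 / (1 + r) := by
    rw [Real.exp_neg, ← one_div]
    exact one_div_le_one_div_of_le (by positivity) (by linarith [Real.add_one_le_exp r])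
  have hle : min 1 r ≤ 2 * (1 - 1 / (1 + r)) := by
    rw [show 2 * (1 - 1 / (1 + r)) = 2 * r / (1 + r) by field_simp; ring,
      le_div_iff₀ (by positivity)]
    rcases le_total 1 r with h | h
    · rw [min_eq_left h]
      linarith
    · rw [min_eq_right h]
      nlinarith
  linarith

lemma mittagLefflerDeriv_nonneg {ρ q : ℝ} (hρ : 0 < ρ) (hq : 0 ≤ q) : 0 ≤ mittagLefflerDeriv ρ q := by
  refine tsum_nonneg fun n => ?_
  have : 0 < Real.Gamma (ρ * n + ρ) := Real.Gamma_pos_of_pos (by positivity)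
  positivity

lemma one_le_Gamma_mul_mittagLeffler {ρ q : ℝ} (h1 : 1 < ρ) (hq : 0 ≤ q) :
    1 ≤ Real.Gamma ρ * mittagLeffler ρ ρ q := by
  have hΓ : 0 < Real.Gamma ρ := Real.Gamma_pos_of_pos (by linarith)
  have h := (summable_pow_div_Gamma h1 q).le_tsum 0 fun m _ => by
    have : 0 < Real.Gamma (ρ * m + ρ) := Real.Gamma_pos_of_pos (by positivity)
    positivity
  rw [pow_zero, Nat.cast_zero, mul_zero, zero_add, div_le_iff₀' hΓ] at h
  exact h

lemma Gamma_mul_mittagLeffler_zero {ρ : ℝ} (hρ : 0 < ρ) :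
    Real.Gamma ρ * mittagLeffler ρ ρ 0 = 1 := by
  rw [mittagLeffler, tsum_eq_single 0 fun n hn => by rw [zero_pow hn, zero_div]]
  simp [(Real.Gamma_pos_of_pos hρ).ne']

lemma lintegral_logDeriv_mittagLeffler {ρ q : ℝ} (h1 : 1 < ρ) (hq : 0 ≤ q) :
    ∫⁻ s in Ioc 0 q, ENNReal.ofReal (mittagLefflerDeriv ρ s / mittagLeffler ρ ρ s) =
      ENNReal.ofReal (Real.log (Real.Gamma ρ * mittagLeffler ρ ρ q)) := by
  have hΓ : 0 < Real.Gamma ρ := Real.Gamma_pos_of_pos (by linarith)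
  have hcont : ContinuousOn (fun s => mittagLefflerDeriv ρ s / mittagLeffler ρ ρ s)
      (uIcc 0 q) := by
    rw [uIcc_of_le hq]
    exact (continuous_mittagLefflerDeriv h1).continuousOn.div
      (fun s _ => (hasDerivAt_mittagLeffler h1 s).continuousAt.continuousWithinAt)
      fun s hs => (mittagLeffler_pos h1 hs.1).ne'
  have hd : ∀ s ∈ uIcc 0 q, HasDerivAt (fun s => Real.log (Real.Gamma ρ * mittagLeffler ρ ρ s))
      (mittagLefflerDeriv ρ s / mittagLeffler ρ ρ s) s := fun s hs => by
    rw [uIcc_of_le hq] at hs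
    have hE := mittagLeffler_pos h1 hs.1
    convert ((hasDerivAt_mittagLeffler h1 s).const_mul (Real.Gamma ρ)).log (by positivity) using 1
    field_simp
  have hInt := hcont.intervalIntegrable (μ := volume)
  have h := intervalIntegral.integral_eq_sub_of_hasDerivAt hd hInt
  rw [Gamma_mul_mittagLeffler_zero (by linarith), Real.log_one, sub_zero,
    intervalIntegral.integral_of_le hq] at h
  rw [← h, ofReal_integral_eq_lintegral_ofReal hInt.1]
  filter_upwards [ae_restrict_mem measurableSet_Ioc] with s hs
  exact div_nonneg (mittagLefflerDeriv_nonneg (by linarith) hs.1.le)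
    (mittagLeffler_pos h1 hs.1.le).le

/-- The Lévy-Khintchine representation of `log (Γ(ρ) E_{ρ,ρ})`, with values in `[0, ∞]`. -/
lemma exists_log_mittagLeffler_eq {ρ : ℝ} (h1 : 1 < ρ) (h2 : ρ < 2) :
    ∃ a : ℝ≥0, ∃ g : ℝ → ℝ≥0∞, Antitone g ∧ (∀ r, 0 < r → g r ≠ ∞) ∧ ∀ q, 0 ≤ q →
      ENNReal.ofReal (Real.log (Real.Gamma ρ * mittagLeffler ρ ρ q)) = a * ENNReal.ofReal q +
        ∫⁻ r in Ioi 0, ENNReal.ofReal ((1 - Real.exp (-q * r)) / r) * g r := by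
  obtain ⟨h, hh, hlim⟩ := exists_antitone_tendsto_laplaceENN h1 h2
  obtain ⟨a, g, hg, hag⟩ := exists_laplaceENN_of_tendsto h hh
    (fun q => mittagLefflerDeriv ρ q / mittagLeffler ρ ρ q) hlim
  refine ⟨a, g, hg, fun r hr htop => ?_, fun q hq => ?_⟩
  · have hle := antitone_mul_le_laplaceENN hg hr
    have hpos : 0 < min r 1 * Real.exp (-1) := by positivity
    rw [htop, ENNReal.mul_top (ENNReal.ofReal_pos.2 hpos).ne', top_le_iff] at hle
    have := hag 1 one_pos
    rw [hle, add_top] at this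
    exact ENNReal.ofReal_ne_top this
  · rw [← lintegral_logDeriv_mittagLeffler h1 hq, ← lintegral_laplaceENN hg hq,
      setLIntegral_congr_fun measurableSet_Ioc fun s hs => hag s hs.1,
      lintegral_add_left measurable_const, setLIntegral_const, Real.volume_Ioc, sub_zero]

/-- Corollary of Section 4.2: for `1 < ρ < 2`, `q ↦ 1/(Γ(ρ) E_{ρ,ρ}(q))` is the Laplace
transform of a self-decomposable probability distribution on `[0,∞)`. -/
theorem mittagLeffler_inv_self_decomposable (ρ : ℝ) (hρ1 : 1 < ρ) (hρ2 : ρ < 2) :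
    ∃ a : ℝ, 0 ≤ a ∧ ∃ k : ℝ → ℝ,
      (∀ r : ℝ, 0 < r → 0 ≤ k r) ∧ AntitoneOn k (Ioi 0) ∧
      IntegrableOn (fun r => min 1 r * (k r / r)) (Ioi 0) volume ∧
      ∀ q : ℝ, 0 ≤ q →
        1 / (Real.Gamma ρ * mittagLeffler ρ ρ q) =
          Real.exp (-(a * q + ∫ r in Ioi (0 : ℝ), (1 - Real.exp (-q * r)) * (k r / r))) := by
  obtain ⟨a, g, hg, hfin, hlog⟩ := exists_log_mittagLeffler_eq hρ1 hρ2
  have hgm : Measurable g := hg.measurable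
  have hterm : ∀ q, 0 ≤ q → ∀ r ∈ Ioi (0 : ℝ), 0 ≤ (1 - Real.exp (-q * r)) / r := fun q hq r hr => by
    have hr : 0 < r := hr
    have : Real.exp (-q * r) ≤ 1 := Real.exp_le_one_iff.2 (by nlinarith)
    exact div_nonneg (by linarith) hr.le
  have hnonneg : ∀ q, 0 ≤ q → 0 ≤ᵐ[volume.restrict (Ioi 0)]
      fun r => (1 - Real.exp (-q * r)) * ((g r).toReal / r) := fun q hq => by
    filter_upwards [ae_restrict_mem measurableSet_Ioi] with r hr
    rw [Pi.zero_apply, mul_div_assoc', mul_div_right_comm]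
    exact mul_nonneg (hterm q hq r hr) ENNReal.toReal_nonneg
  have heq : ∀ q, 0 ≤ q → ENNReal.ofReal (Real.log (Real.Gamma ρ * mittagLeffler ρ ρ q)) =
      a * ENNReal.ofReal q + ∫⁻ r in Ioi 0,
        ENNReal.ofReal ((1 - Real.exp (-q * r)) * ((g r).toReal / r)) := fun q hq => by
    rw [hlog q hq]
    congr 1
    refine setLIntegral_congr_fun measurableSet_Ioi fun r hr => ?_
    rw [mul_div_assoc', mul_div_right_comm, ENNReal.ofReal_mul (hterm q hq r hr),
      ENNReal.ofReal_toReal (hfin r hr)]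
  have hInt : ∀ q, 0 ≤ q → IntegrableOn
      (fun r => (1 - Real.exp (-q * r)) * ((g r).toReal / r)) (Ioi 0) := fun q hq => by
    refine ⟨(by fun_prop : Measurable _).aestronglyMeasurable, ?_⟩
    rw [hasFiniteIntegral_iff_ofReal (hnonneg q hq)]
    refine lt_of_le_of_lt le_add_self (lt_of_eq_of_lt (heq q hq).symm ENNReal.ofReal_lt_top)
  refine ⟨a, a.coe_nonneg, fun r => (g r).toReal, fun r _ => ENNReal.toReal_nonneg,
    fun r hr s _ hrs => ENNReal.toReal_mono (hfin r hr) (hg hrs), ?_, fun q hq => ?_⟩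
  · refine ((hInt 1 zero_le_one).const_mul 2).mono'
      (by fun_prop : Measurable _).aestronglyMeasurable ?_
    filter_upwards [ae_restrict_mem measurableSet_Ioi] with r hr
    have hr : 0 < r := hr
    rw [Real.norm_of_nonneg (by positivity), ← mul_assoc, neg_one_mul]
    gcongr
    exact min_one_le_two_mul_one_sub_exp hr
  · have hE := mittagLeffler_pos hρ1 hq
    have hΓ : 0 < Real.Gamma ρ := Real.Gamma_pos_of_pos (by linarith)
    have hI := integral_nonneg_of_ae (hnonneg q hq)
    have h := heq q hq
    rw [← ofReal_integral_eq_lintegral_ofReal (hInt q hq) (hnonneg q hq),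
      ← ENNReal.ofReal_coe_nnreal, ← ENNReal.ofReal_mul a.coe_nonneg,
      ← ENNReal.ofReal_add (by positivity) hI, ENNReal.ofReal_eq_ofReal_iff
        (Real.log_nonneg (one_le_Gamma_mul_mittagLeffler hρ1 hq)) (by positivity)] at h
    rw [← h, Real.exp_neg, Real.exp_log (by positivity), one_div]
end

section
/- (Corollary, Section 4.2, complete monotonicity.) Let 1 < ρ < 2. Then the function f(q) = E_{ρ,ρ−1}(q) − q^{1/ρ}·E_{ρ,ρ}(q) is completely monotone on (0,∞): f is infinitely differentiable on (0,∞) and (−1)^n f^{(n)}(q) ≥ 0 for every integer n ≥ 0 and every q > 0. (This f is, up to the normalizing factor Γ(ρ−1) and a linear change of variable, the function N_{ρ,ψ,1} of Theorem 2.2 for ψ(u) = (1/ρ)Γ(u−1+ρ)/Γ(u−1).) -/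
open MeasureTheory Real Set Filter Topology

/-- All iterated alternating differences of `f` of order at most `n` whose nodes lie in `(0, R)`
are nonnegative. -/
def AltDiffNonneg : ℕ → ℝ → (ℝ → ℝ) → Prop
  | 0, R, f => ∀ q, 0 < q → q < R → 0 ≤ f q
  | n + 1, R, f => (∀ q, 0 < q → q < R → 0 ≤ f q) ∧
      ∀ h, 0 < h → AltDiffNonneg n (R - h) (fun q => f q - f (q + h))

namespace AltDiffNonneg

variable {n : ℕ} {R : ℝ} {f g : ℝ → ℝ}

theorem nonneg (hf : AltDiffNonneg n R f) {q : ℝ} (h0 : 0 < q) (hR : q < R) : 0 ≤ f q := by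
  cases n with
  | zero => exact hf q h0 hR
  | succ n => exact hf.1 q h0 hR

theorem mono {R' : ℝ} (hf : AltDiffNonneg n R f) (hR : R' ≤ R) : AltDiffNonneg n R' f := by
  induction n generalizing R R' f with
  | zero => exact fun q h0 h1 => hf q h0 (h1.trans_le hR)
  | succ n ih =>
    exact ⟨fun q h0 h1 => hf.1 q h0 (h1.trans_le hR), fun h hh => ih (hf.2 h hh) (by linarith)⟩

theorem of_succ (hf : AltDiffNonneg (n + 1) R f) : AltDiffNonneg n R f := by
  induction n generalizing R f with
  | zero => exact hf.1
  | succ n ih => exact ⟨hf.1, fun h hh => ih (hf.2 h hh)⟩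

theorem congr (hf : AltDiffNonneg n R f) (hfg : ∀ q, 0 < q → q < R → f q = g q) :
    AltDiffNonneg n R g := by
  induction n generalizing R f g with
  | zero => exact fun q h0 h1 => hfg q h0 h1 ▸ hf q h0 h1
  | succ n ih =>
    refine ⟨fun q h0 h1 => hfg q h0 h1 ▸ hf.1 q h0 h1, fun h hh => ih (hf.2 h hh) ?_⟩
    intro q h0 h1
    rw [hfg q h0 (by linarith), hfg (q + h) (by linarith) (by linarith)]

theorem comp_add (hf : AltDiffNonneg n R f) {h : ℝ} (hh : 0 < h) :
    AltDiffNonneg n (R - h) (fun q => f (q + h)) := by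
  induction n generalizing R f with
  | zero => exact fun q h0 h1 => hf _ (by linarith) (by linarith)
  | succ n ih =>
    refine ⟨fun q h0 h1 => hf.1 _ (by linarith) (by linarith), fun k hk => ?_⟩
    refine (mono (ih (hf.2 k hk)) (by linarith : R - h - k ≤ R - k - h)).congr ?_
    intro q _ _
    rw [add_right_comm]

theorem const {c : ℝ} (hc : 0 ≤ c) (n : ℕ) (R : ℝ) : AltDiffNonneg n R (fun _ => c) := by
  induction n generalizing c R with
  | zero => exact fun _ _ _ => hc
  | succ n ih =>
    refine ⟨fun _ _ _ => hc, fun h _ => ?_⟩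
    simpa using ih le_rfl (R - h)

theorem add (hf : AltDiffNonneg n R f) (hg : AltDiffNonneg n R g) :
    AltDiffNonneg n R (fun q => f q + g q) := by
  induction n generalizing R f g with
  | zero => exact fun q h0 h1 => add_nonneg (hf q h0 h1) (hg q h0 h1)
  | succ n ih =>
    refine ⟨fun q h0 h1 => add_nonneg (hf.1 q h0 h1) (hg.1 q h0 h1), fun h hh => ?_⟩
    exact (ih (hf.2 h hh) (hg.2 h hh)).congr fun q _ _ => by ring

theorem mul (hf : AltDiffNonneg n R f) (hg : AltDiffNonneg n R g) :
    AltDiffNonneg n R (fun q => f q * g q) := by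
  induction n generalizing R f g with
  | zero => exact fun q h0 h1 => mul_nonneg (hf q h0 h1) (hg q h0 h1)
  | succ n ih =>
    refine ⟨fun q h0 h1 => mul_nonneg (hf.1 q h0 h1) (hg.1 q h0 h1), fun h hh => ?_⟩
    have h1 := ih (hf.2 h hh) (hg.of_succ.mono (by linarith : R - h ≤ R))
    have h2 := ih (hf.of_succ.comp_add hh) (hg.2 h hh)
    exact (h1.add h2).congr fun q _ _ => by ring

theorem pow (hf : AltDiffNonneg n R f) (m : ℕ) : AltDiffNonneg n R (fun q => f q ^ m) := by
  induction m with
  | zero => simpa using const zero_le_one n R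
  | succ m ih => simpa [pow_succ] using ih.mul hf

theorem sum {ι : Type*} {F : ι → ℝ → ℝ} (s : Finset ι)
    (hF : ∀ i ∈ s, AltDiffNonneg n R (F i)) : AltDiffNonneg n R (fun q => ∑ i ∈ s, F i q) := by
  classical
  induction s using Finset.induction_on with
  | empty => simpa using const le_rfl n R
  | insert a s ha ih =>
    simp only [Finset.sum_insert ha]
    exact (hF a (by simp)).add (ih fun i hi => hF i (by simp [hi]))

theorem of_tendsto {F : ℕ → ℝ → ℝ} (hF : ∀ᶠ k in atTop, AltDiffNonneg n R (F k))
    (hlim : ∀ q, 0 < q → q < R → Tendsto (fun k => F k q) atTop (𝓝 (f q))) :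
    AltDiffNonneg n R f := by
  induction n generalizing R f F with
  | zero =>
    exact fun q h0 h1 => ge_of_tendsto (hlim q h0 h1) (hF.mono fun k hk => hk q h0 h1)
  | succ n ih =>
    refine ⟨fun q h0 h1 => ge_of_tendsto (hlim q h0 h1) (hF.mono fun k hk => hk.1 q h0 h1),
      fun h hh => ih (hF.mono fun k hk => hk.2 h hh) fun q h0 h1 => ?_⟩
    exact (hlim q h0 (by linarith)).sub (hlim _ (by linarith) (by linarith))

theorem of_hasSum {F : ℕ → ℝ → ℝ} (hF : ∀ k, AltDiffNonneg n R (F k))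
    (hsum : ∀ q, 0 < q → q < R → HasSum (fun k => F k q) (f q)) : AltDiffNonneg n R f :=
  of_tendsto (F := fun k q => ∑ i ∈ Finset.range k, F i q)
    (Eventually.of_forall fun _ => sum _ fun i _ => hF i)
    fun q h0 h1 => (hsum q h0 h1).tendsto_sum_nat

theorem sub_comp_add_nonneg {f' : ℝ → ℝ} (hd : ∀ q, 0 < q → q < R → HasDerivAt f (f' q) q)
    (hf' : ∀ q, 0 < q → q < R → f' q ≤ 0) {h : ℝ} (hh : 0 < h) {q : ℝ} (h0 : 0 < q)
    (h1 : q < R - h) : 0 ≤ f q - f (q + h) := by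
  have : AntitoneOn f (Ioo 0 R) := by
    refine antitoneOn_of_deriv_nonpos (convex_Ioo 0 R)
      (fun x hx => (hd x hx.1 hx.2).continuousAt.continuousWithinAt) ?_ ?_
    · rw [interior_Ioo]
      exact fun x hx => (hd x hx.1 hx.2).differentiableAt.differentiableWithinAt
    · rw [interior_Ioo]
      intro x hx
      rw [(hd x hx.1 hx.2).deriv]
      exact hf' x hx.1 hx.2
  exact sub_nonneg.2 (this ⟨h0, by linarith⟩ ⟨by linarith, by linarith⟩ (by linarith))

theorem of_neg_deriv {f' : ℝ → ℝ} (hf : ∀ q, 0 < q → q < R → 0 ≤ f q)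
    (hd : ∀ q, 0 < q → q < R → HasDerivAt f (f' q) q)
    (hf' : AltDiffNonneg n R (fun q => -f' q)) : AltDiffNonneg (n + 1) R f := by
  have hanti : ∀ h, 0 < h → ∀ q, 0 < q → q < R - h → 0 ≤ f q - f (q + h) := fun h hh q h0 h1 =>
    sub_comp_add_nonneg hd (fun x h0 h1 => neg_nonneg.1 (hf'.nonneg h0 h1)) hh h0 h1
  induction n generalizing R f f' with
  | zero => exact ⟨hf, hanti⟩
  | succ n ih =>
    refine ⟨hf, fun h hh => ?_⟩
    have hd2 : ∀ q, 0 < q → q < R - h →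
        HasDerivAt (fun q => f q - f (q + h)) (f' q - f' (q + h)) q := fun q h0 h1 =>
      (hd q h0 (by linarith)).sub ((hd (q + h) (by linarith) (by linarith)).comp_add_const q h)
    have hd' : AltDiffNonneg n (R - h) (fun q => -(f' q - f' (q + h))) :=
      (hf'.2 h hh).congr fun q _ _ => by ring
    exact ih (hanti h hh) hd2 hd' fun k hk q h0 h1 =>
      sub_comp_add_nonneg hd2 (fun x h0 h1 => neg_nonneg.1 (hd'.nonneg h0 h1)) hk h0 h1

theorem rpow_neg {γ : ℝ} (hγ : 0 ≤ γ) (n : ℕ) (R : ℝ) :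
    AltDiffNonneg n R (fun q => q ^ (-γ)) := by
  induction n generalizing γ with
  | zero => exact fun q h0 _ => rpow_nonneg h0.le _
  | succ n ih =>
    refine of_neg_deriv (f' := fun q => -γ * q ^ (-γ - 1)) (fun q h0 _ => rpow_nonneg h0.le _)
      (fun q h0 _ => Real.hasDerivAt_rpow_const (Or.inl h0.ne')) ?_
    refine ((const hγ n R).mul (ih (γ := γ + 1) (by linarith))).congr fun q _ _ => ?_
    rw [neg_add']
    ring

theorem neg_deriv (hf : ∀ n R, AltDiffNonneg n R f) (hd : ∀ q, 0 < q → DifferentiableAt ℝ f q)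
    (n : ℕ) (R : ℝ) : AltDiffNonneg n R (fun q => -deriv f q) := by
  refine of_tendsto (F := fun k q => ((k : ℝ) + 1) * (f q - f (q + 1 / ((k : ℝ) + 1))))
    (Eventually.of_forall fun k => ?_) fun q h0 _ => ?_
  · have hk : (0 : ℝ) < 1 / ((k : ℝ) + 1) := by positivity
    have h1 := (hf (n + 1) (R + 1 / ((k : ℝ) + 1))).2 _ hk
    rw [add_sub_cancel_right] at h1
    exact (const (by positivity) n R).mul h1
  · have h1 := (hd q h0).hasDerivAt.tendsto_slope_zero_right
    have h2 : Tendsto (fun k : ℕ => 1 / ((k : ℝ) + 1)) atTop (𝓝[>] 0) :=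
      tendsto_nhdsWithin_iff.2 ⟨tendsto_one_div_add_atTop_nhds_zero_nat,
        Eventually.of_forall fun k => by simp only [mem_Ioi]; positivity⟩
    refine (h1.comp h2).neg.congr fun k => ?_
    simp only [Function.comp_apply, smul_eq_mul, one_div, inv_inv]
    ring

theorem iteratedDeriv_nonneg (hf : ∀ n R, AltDiffNonneg n R f)
    (hs : ContDiffOn ℝ (⊤ : ℕ∞) f (Ioi 0)) (n : ℕ) {q : ℝ} (hq : 0 < q) :
    0 ≤ (-1 : ℝ) ^ n * iteratedDeriv n f q := by
  induction n generalizing f with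
  | zero => simpa using (hf 0 (q + 1)).nonneg hq (by linarith)
  | succ n ih =>
    have hd : ∀ q, 0 < q → DifferentiableAt ℝ f q := fun q hq =>
      (hs.differentiableOn (by simp)).differentiableAt (Ioi_mem_nhds hq)
    have hs' : ContDiffOn ℝ (⊤ : ℕ∞) (deriv f) (Ioi 0) :=
      hs.deriv_of_isOpen isOpen_Ioi (by simp)
    have h1 := ih (neg_deriv hf hd) hs'.neg
    rw [iteratedDeriv_fun_neg] at h1
    rw [iteratedDeriv_succ', pow_succ]
    linarith

end AltDiffNonneg

/-- The coefficient of `z ^ n` in the binomial series `(1 - z) ^ (-β)`. -/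
noncomputable def negBinom (β : ℝ) (n : ℕ) : ℝ :=
  (∏ j ∈ Finset.range n, (β + j)) / n.factorial

namespace negBinom

@[simp]
theorem zero_right (β : ℝ) : negBinom β 0 = 1 := by simp [negBinom]

theorem succ (β : ℝ) (n : ℕ) : negBinom β (n + 1) = negBinom β n * ((β + n) / (n + 1)) := by
  simp only [negBinom, Finset.prod_range_succ, Nat.factorial_succ, Nat.cast_mul, Nat.cast_succ]
  field_simp

theorem one_right (β : ℝ) : negBinom β 1 = β := by simp [negBinom]

theorem eq_choose (β : ℝ) (n : ℕ) : negBinom β n = (-1) ^ n * Ring.choose (-β) n := by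
  rw [Ring.choose_neg, ← Ring.multichoose_eq]
  have h := Ring.factorial_nsmul_multichoose_eq_ascPochhammer β n
  have hprod : (ascPochhammer ℝ n).eval β = ∏ j ∈ Finset.range n, (β + j) := by
    clear h
    induction n with
    | zero => simp
    | succ n ih => rw [ascPochhammer_succ_eval, ih, Finset.prod_range_succ]
  rw [Polynomial.ascPochhammer_smeval_cast, Polynomial.ascPochhammer_smeval_eq_eval, hprod,
    nsmul_eq_mul] at h
  have hn : (n.factorial : ℝ) ≠ 0 := by positivity
  rw [negBinom, ← h, mul_div_cancel_left₀ _ hn, Int.negOnePow_def, Units.smul_def]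
  simp [← mul_assoc, ← mul_pow]

theorem nonneg {β : ℝ} (hβ : 0 ≤ β) (n : ℕ) : 0 ≤ negBinom β n := by
  unfold negBinom
  positivity

theorem le_pow {β : ℝ} (hβ : 0 ≤ β) (n : ℕ) : negBinom β n ≤ (1 + β) ^ n := by
  induction n with
  | zero => simp
  | succ n ih =>
    rw [succ, pow_succ]
    have : (β + n) / (n + 1) ≤ 1 + β := by
      rw [div_le_iff₀ (by positivity)]
      nlinarith [mul_nonneg hβ (Nat.cast_nonneg (α := ℝ) n)]
    exact mul_le_mul ih this (by positivity) (by positivity)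

/-- The formal power series `(1 - X) ^ (-β)`. -/
noncomputable def series (β : ℝ) : PowerSeries ℝ := PowerSeries.mk (negBinom β)

theorem series_eq (β : ℝ) :
    series β = PowerSeries.rescale (-1) (PowerSeries.binomialSeries ℝ (-β)) := by
  ext n
  simp [series, eq_choose]

theorem series_add (β γ : ℝ) : series (β + γ) = series β * series γ := by
  rw [series_eq, series_eq, series_eq, neg_add, PowerSeries.binomialSeries_add, map_mul]

theorem series_zero : series 0 = 1 := by
  rw [series_eq, neg_zero, PowerSeries.binomialSeries_zero, map_one]

theorem series_neg_one : series (-1) = 1 - PowerSeries.X := by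
  have := PowerSeries.binomialSeries_nat (R := ℝ) (A := ℝ) 1
  rw [series_eq, neg_neg]
  simp only [Nat.cast_one, pow_one] at this
  rw [this, map_add, map_one, PowerSeries.rescale_X]
  simp [sub_eq_add_neg]

theorem hasSum (β : ℝ) {x : ℝ} (hx : |x| < 1) :
    HasSum (fun n => negBinom β n * x ^ n) ((1 - x) ^ (-β)) := by
  have h := (Real.one_add_rpow_hasFPowerSeriesOnBall_zero (a := -β)).hasSum (y := -x)
    (by simpa [Metric.mem_eball, edist_dist, ENNReal.ofReal_lt_one] using hx)
  rw [zero_add, ← sub_eq_add_neg] at h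
  refine h.congr_fun ?_
  intro n
  rw [eq_choose]
  simp [binomialSeries, neg_pow x]
  ring

end negBinom

namespace negBinom

theorem summable_pow_mul {ρ c s : ℝ} (hρ : 0 ≤ ρ) (hc : 0 ≤ c) (hs0 : 0 < s) (hs1 : s < 1)
    (n : ℕ) : Summable (fun k : ℕ => s ^ k * negBinom (ρ * k + c) n) := by
  have h1 : Summable (fun k : ℕ => ((k + 1 : ℕ) : ℝ) ^ n * s ^ (k + 1)) :=
    (summable_nat_add_iff 1 (f := fun k : ℕ => (k : ℝ) ^ n * s ^ k)).2
      (summable_pow_mul_geometric_of_norm_lt_one n (by rwa [norm_of_nonneg hs0.le]))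
  refine (h1.mul_left ((1 + ρ + c) ^ n * s⁻¹)).of_nonneg_of_le
    (fun k => mul_nonneg (by positivity) (nonneg (by positivity) n)) fun k => ?_
  have h2 : negBinom (ρ * k + c) n ≤ ((1 + ρ + c) * (k + 1)) ^ n := by
    refine (le_pow (by positivity) n).trans (pow_le_pow_left₀ (by positivity) ?_ n)
    have : (0 : ℝ) ≤ (1 + c) * k := by positivity
    linarith
  calc s ^ k * negBinom (ρ * k + c) n ≤ s ^ k * ((1 + ρ + c) * (k + 1)) ^ n := by gcongr
    _ = (1 + ρ + c) ^ n * s⁻¹ * (((k + 1 : ℕ) : ℝ) ^ n * s ^ (k + 1)) := by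
      rw [mul_pow, pow_succ]
      push_cast
      field_simp

/-- The coefficient of `z ^ n` in `∑ k, s ^ k * (1 - z) ^ (-(ρ * k + c))`. -/
noncomputable def geomSum (ρ c s : ℝ) (n : ℕ) : ℝ :=
  ∑' k : ℕ, s ^ k * negBinom (ρ * k + c) n

theorem series_sub_mul_geomSum {ρ c s : ℝ} (hρ : 0 ≤ ρ) (hc : 0 ≤ c + ρ) (hs0 : 0 < s)
    (hs1 : s < 1) :
    (series (-ρ) - PowerSeries.C s) * PowerSeries.mk (geomSum ρ (c + ρ) s) = series c := by
  ext n
  rw [sub_mul, map_sub, PowerSeries.coeff_C_mul, PowerSeries.coeff_mul]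
  simp only [series, PowerSeries.coeff_mk]
  have hS : ∀ n, HasSum (fun k : ℕ => s ^ k * negBinom (ρ * k + (c + ρ)) n)
      (geomSum ρ (c + ρ) s n) := fun n => (summable_pow_mul hρ hc hs0 hs1 n).hasSum
  have h1 : HasSum (fun k : ℕ => s ^ k * negBinom (ρ * k + c) n)
      (∑ p ∈ Finset.HasAntidiagonal.antidiagonal n, negBinom (-ρ) p.1 * geomSum ρ (c + ρ) s p.2) := by
    refine (hasSum_sum fun p (_ : p ∈ Finset.HasAntidiagonal.antidiagonal n) =>
      (hS p.2).mul_left (negBinom (-ρ) p.1)).congr_fun fun k => ?_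
    have h := congrArg (PowerSeries.coeff n) (series_add (-ρ) (ρ * k + (c + ρ)))
    rw [PowerSeries.coeff_mul, show -ρ + (ρ * k + (c + ρ)) = ρ * k + c by ring] at h
    simp only [series, PowerSeries.coeff_mk] at h
    rw [h, Finset.mul_sum]
    exact Finset.sum_congr rfl fun p _ => by ring
  have h2 : HasSum (fun k : ℕ => s ^ (k + 1) * negBinom (ρ * (k + 1 : ℕ) + c) n)
      (s * geomSum ρ (c + ρ) s n) := by
    refine ((hS n).mul_left s).congr_fun fun k => ?_
    rw [show ρ * ((k + 1 : ℕ) : ℝ) + c = ρ * k + (c + ρ) by push_cast; ring]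
    ring
  have h3 := (hasSum_nat_add_iff' 1).2 h1
  have h4 := h3.unique h2
  simp only [Finset.range_one, Finset.sum_singleton, pow_zero, one_mul, Nat.cast_zero, mul_zero,
    zero_add] at h4
  linarith

theorem neg_mem_Icc {ρ : ℝ} (hρ1 : 1 < ρ) (hρ2 : ρ < 2) (j : ℕ) :
    negBinom (-ρ) (j + 2) ∈ Icc (0 : ℝ) 1 := by
  induction j with
  | zero =>
    rw [zero_add, succ, one_right]
    constructor <;> norm_num <;> nlinarith
  | succ j ih =>
    rw [succ]
    push_cast
    have h1 : 0 ≤ (-ρ + (j + 2 : ℝ)) / (j + 2 + 1) :=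
      div_nonneg (by linarith [Nat.cast_nonneg (α := ℝ) j]) (by positivity)
    have h2 : (-ρ + (j + 2 : ℝ)) / (j + 2 + 1) ≤ 1 := by
      rw [div_le_one (by positivity)]
      linarith
    exact ⟨mul_nonneg ih.1 h1, mul_le_one₀ ih.2 h1 h2⟩

end negBinom

/-- The coefficients of `(1 - z) ^ ρ - 1 + ρ * z`. -/
noncomputable def jumpCoeff (ρ : ℝ) (j : ℕ) : ℝ := if j < 2 then 0 else negBinom (-ρ) j

/-- The coefficient of `x ^ i` in `ρ - ((1 - x) ^ ρ - (1 - z) ^ ρ) / (z - x)`. -/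
noncomputable def ladderCoeff (ρ : ℝ) (i : ℕ) (z : ℝ) : ℝ :=
  ∑' m : ℕ, jumpCoeff ρ (i + 1 + m) * z ^ m

/-- The coefficient of `x ^ n` in `(z - x) / ((1 - x) ^ ρ - (1 - z) ^ ρ)`. -/
noncomputable def ladderPotential (ρ : ℝ) (n : ℕ) (z : ℝ) : ℝ :=
  negBinom.geomSum ρ (ρ - 1) ((1 - z) ^ ρ) n - (1 - z) * negBinom.geomSum ρ ρ ((1 - z) ^ ρ) n

section Ladder

variable {ρ : ℝ}

theorem jumpCoeff_mem_Icc (hρ1 : 1 < ρ) (hρ2 : ρ < 2) (j : ℕ) :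
    jumpCoeff ρ j ∈ Icc (0 : ℝ) 1 := by
  unfold jumpCoeff
  split_ifs with h
  · simp
  · obtain ⟨i, rfl⟩ := Nat.exists_eq_add_of_le' (not_lt.1 h)
    exact negBinom.neg_mem_Icc hρ1 hρ2 i

theorem hasSum_ladderCoeff (hρ1 : 1 < ρ) (hρ2 : ρ < 2) (i : ℕ) {z : ℝ} (hz0 : 0 < z)
    (hz1 : z < 1) :
    HasSum (fun m : ℕ => jumpCoeff ρ (i + 1 + m) * z ^ m) (ladderCoeff ρ i z) := by
  refine Summable.hasSum ((summable_geometric_of_lt_one hz0.le hz1).of_nonneg_of_le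
    (fun m => mul_nonneg (jumpCoeff_mem_Icc hρ1 hρ2 _).1 (by positivity)) fun m => ?_)
  exact mul_le_of_le_one_left (by positivity) (jumpCoeff_mem_Icc hρ1 hρ2 _).2

theorem ladderCoeff_eq (hρ1 : 1 < ρ) (hρ2 : ρ < 2) (i : ℕ) {z : ℝ} (hz0 : 0 < z)
    (hz1 : z < 1) : ladderCoeff ρ i z = jumpCoeff ρ (i + 1) + z * ladderCoeff ρ (i + 1) z := by
  have h1 := (hasSum_nat_add_iff' 1).2 (hasSum_ladderCoeff hρ1 hρ2 i hz0 hz1)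
  have h2 : HasSum (fun m : ℕ => jumpCoeff ρ (i + 1 + (m + 1)) * z ^ (m + 1))
      (z * ladderCoeff ρ (i + 1) z) := by
    refine ((hasSum_ladderCoeff hρ1 hρ2 (i + 1) hz0 hz1).mul_left z).congr_fun fun m => ?_
    rw [show i + 1 + (m + 1) = i + 1 + 1 + m by ring]
    ring
  have h3 := h1.unique h2
  simp only [Finset.range_one, Finset.sum_singleton, pow_zero, mul_one, add_zero] at h3
  linarith

theorem mul_sub_ladderCoeff_zero (hρ1 : 1 < ρ) (hρ2 : ρ < 2) {z : ℝ} (hz0 : 0 < z)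
    (hz1 : z < 1) : z * (ρ - ladderCoeff ρ 0 z) = 1 - (1 - z) ^ ρ := by
  have h1 := negBinom.hasSum (-ρ) (x := z) (by rwa [abs_of_pos hz0])
  have h2 := (hasSum_nat_add_iff' 2).2 h1
  have h3 : HasSum (fun m : ℕ => negBinom (-ρ) (m + 2) * z ^ (m + 2))
      (z * (z * ladderCoeff ρ 1 z)) := by
    refine (((hasSum_ladderCoeff hρ1 hρ2 1 hz0 hz1).mul_left z).mul_left z).congr_fun fun m => ?_
    rw [jumpCoeff, if_neg (by lia), show 1 + 1 + m = m + 2 by ring]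
    ring
  have h4 := h2.unique h3
  rw [ladderCoeff_eq hρ1 hρ2 0 hz0 hz1, jumpCoeff, if_pos (by simp), zero_add, zero_add]
  simp only [Finset.sum_range_succ, Finset.range_zero, Finset.sum_empty, negBinom.zero_right,
    negBinom.one_right, neg_neg] at h4
  linarith

theorem ladder_mul_potential (hρ1 : 1 < ρ) (hρ2 : ρ < 2) {z : ℝ} (hz0 : 0 < z) (hz1 : z < 1) :
    (PowerSeries.C ρ - PowerSeries.mk fun i => ladderCoeff ρ i z) *
      PowerSeries.mk (fun n => ladderPotential ρ n z) = 1 := by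
  have hs0 : 0 < (1 - z) ^ ρ := rpow_pos_of_pos (by linarith) _
  have hs1 : (1 - z) ^ ρ < 1 := rpow_lt_one (by linarith) (by linarith) (by linarith)
  have hK : (PowerSeries.C z - PowerSeries.X) *
      (PowerSeries.C ρ - PowerSeries.mk fun i => ladderCoeff ρ i z) =
      negBinom.series (-ρ) - PowerSeries.C ((1 - z) ^ ρ) := by
    ext n
    rw [sub_mul, map_sub, PowerSeries.coeff_C_mul]
    rcases n with _ | n
    · have := mul_sub_ladderCoeff_zero hρ1 hρ2 hz0 hz1
      simpa [negBinom.series] using this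
    · rw [PowerSeries.coeff_succ_X_mul]
      have := ladderCoeff_eq hρ1 hρ2 n hz0 hz1
      rcases n with _ | n
      · simp [negBinom.series, negBinom.one_right, jumpCoeff] at this ⊢
        linarith
      · simp [negBinom.series, jumpCoeff] at this ⊢
        linarith
  have hU : (PowerSeries.mk fun n => ladderPotential ρ n z) =
      PowerSeries.mk (negBinom.geomSum ρ (-1 + ρ) ((1 - z) ^ ρ)) -
        PowerSeries.C (1 - z) * PowerSeries.mk (negBinom.geomSum ρ (0 + ρ) ((1 - z) ^ ρ)) := by
    ext n
    simp [ladderPotential, PowerSeries.coeff_C_mul, neg_add_eq_sub, sub_mul]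
  have h1 := negBinom.series_sub_mul_geomSum (ρ := ρ) (c := -1) (by linarith) (by linarith) hs0 hs1
  have h2 := negBinom.series_sub_mul_geomSum (ρ := ρ) (c := 0) (by linarith) (by linarith) hs0 hs1
  rw [negBinom.series_neg_one] at h1
  rw [negBinom.series_zero] at h2
  have hne : (PowerSeries.C z - PowerSeries.X : PowerSeries ℝ) ≠ 0 := by
    intro h
    have := congrArg (PowerSeries.coeff 0) h
    simp at this
    exact hz0.ne' this
  refine mul_left_cancel₀ hne ?_
  rw [← mul_assoc, hK, hU, mul_sub, mul_left_comm, h1, h2, map_sub, map_one]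
  ring

theorem AltDiffNonneg.ladderPotential (hρ1 : 1 < ρ) (hρ2 : ρ < 2) {n : ℕ} {R : ℝ} {z : ℝ → ℝ}
    (hz : AltDiffNonneg n R z) (hz0 : ∀ q, 0 < q → q < R → 0 < z q)
    (hz1 : ∀ q, 0 < q → q < R → z q < 1) (m : ℕ) :
    AltDiffNonneg n R (fun q => _root_.ladderPotential ρ m (z q)) := by
  have hC : ∀ i, AltDiffNonneg n R (fun q => ladderCoeff ρ i (z q)) := fun i =>
    of_hasSum (fun k => (const (jumpCoeff_mem_Icc hρ1 hρ2 (i + 1 + k)).1 n R).mul (hz.pow k))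
      fun q h0 h1 => hasSum_ladderCoeff hρ1 hρ2 i (hz0 q h0 h1) (hz1 q h0 h1)
  have hpos : ∀ q, 0 < q → q < R → 0 < ρ - ladderCoeff ρ 0 (z q) := by
    intro q h0 h1
    have h2 := mul_sub_ladderCoeff_zero hρ1 hρ2 (hz0 q h0 h1) (hz1 q h0 h1)
    have h3 : (1 - z q) ^ ρ < 1 :=
      rpow_lt_one (by linarith [hz1 q h0 h1]) (by linarith [hz0 q h0 h1]) (by linarith)
    exact pos_of_mul_pos_right (by linarith : 0 < z q * (ρ - ladderCoeff ρ 0 (z q)))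
      (hz0 q h0 h1).le
  have hinv : AltDiffNonneg n R (fun q => (ρ - ladderCoeff ρ 0 (z q))⁻¹) := by
    refine of_hasSum (F := fun k q => ρ⁻¹ ^ (k + 1) * ladderCoeff ρ 0 (z q) ^ k)
      (fun k => (const (by positivity) n R).mul ((hC 0).pow k)) fun q h0 h1 => ?_
    have h2 : 0 ≤ ladderCoeff ρ 0 (z q) := (hC 0).nonneg h0 h1
    have h3 : ladderCoeff ρ 0 (z q) / ρ < 1 := by
      rw [div_lt_one (by linarith)]
      linarith [hpos q h0 h1]
    have h4 := (hasSum_geometric_of_lt_one (div_nonneg h2 (by linarith)) h3).mul_left ρ⁻¹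
    have h5 : ρ - ladderCoeff ρ 0 (z q) ≠ 0 := (hpos q h0 h1).ne'
    have h6 : ρ ≠ 0 := by linarith
    convert! h4 using 1
    · ext k
      rw [div_eq_mul_inv, mul_pow]
      ring
    · rw [← mul_inv, mul_sub, mul_one, mul_div_cancel₀ _ h6]
  have hmul := fun q (h0 : 0 < q) (h1 : q < R) =>
    ladder_mul_potential hρ1 hρ2 (hz0 q h0 h1) (hz1 q h0 h1)
  induction m using Nat.strong_induction_on with
  | _ m ih =>
    rcases m with _ | m
    · refine hinv.congr fun q h0 h1 => inv_eq_of_mul_eq_one_right ?_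
      have := congrArg (PowerSeries.coeff 0) (hmul q h0 h1)
      simpa using this
    · have hs : AltDiffNonneg n R (fun q => ∑ i ∈ Finset.range (m + 1),
          ladderCoeff ρ (i + 1) (z q) * _root_.ladderPotential ρ (m - i) (z q)) :=
        sum _ fun i _ => (hC (i + 1)).mul (ih (m - i) (by lia))
      refine (hinv.mul hs).congr fun q h0 h1 => ?_
      have h2 := congrArg (PowerSeries.coeff (m + 1)) (hmul q h0 h1)
      rw [sub_mul, map_sub, PowerSeries.coeff_C_mul, PowerSeries.coeff_mul,
        Finset.Nat.sum_antidiagonal_eq_sum_range_succ_mk, Finset.sum_range_succ'] at h2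
      simp [PowerSeries.coeff_one] at h2
      rw [inv_mul_eq_iff_eq_mul₀ (hpos q h0 h1).ne']
      linarith

end Ladder

namespace negBinom

theorem tendsto_rpow_mul {β : ℝ} (hβ : 0 < β) :
    Tendsto (fun N : ℕ => (N : ℝ) ^ (1 - β) * negBinom β N) atTop (𝓝 (Gamma β)⁻¹) := by
  have h1 := (GammaSeq_tendsto_Gamma β).inv₀ (Gamma_pos_of_pos hβ).ne'
  have h2 : Tendsto (fun N : ℕ => (N : ℝ) / (N + β)) atTop (𝓝 1) :=
    tendsto_natCast_div_add_atTop β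
  have h3 := h2.mul h1
  rw [one_mul] at h3
  refine h3.congr' ?_
  filter_upwards [eventually_gt_atTop 0] with N hN
  have hN' : (0 : ℝ) < N := by exact_mod_cast hN
  have hp : (0 : ℝ) < ∏ j ∈ Finset.range N, (β + j) := Finset.prod_pos fun j _ => by positivity
  have hr : (0 : ℝ) < (N : ℝ) ^ β := by positivity
  rw [GammaSeq, negBinom, Finset.prod_range_succ, rpow_sub hN', rpow_one]
  field_simp
  ring

theorem rpow_mul_succ_le {β : ℝ} (hβ : 1 ≤ β) {N : ℕ} (hN : 0 < N) :
    ((N + 1 : ℕ) : ℝ) ^ (1 - β) * negBinom β (N + 1) ≤ (N : ℝ) ^ (1 - β) * negBinom β N := by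
  have hN' : (0 : ℝ) < N := by exact_mod_cast hN
  have hb : 1 + β * (1 / N) ≤ (1 + 1 / (N : ℝ)) ^ β :=
    one_add_mul_self_le_rpow_one_add (by linarith [show 0 < 1 / (N : ℝ) by positivity]) hβ
  have h1 : (0 : ℝ) < (N : ℝ) ^ β := by positivity
  have h2 : (0 : ℝ) < ((N + 1 : ℕ) : ℝ) ^ β := by positivity
  rw [show 1 + 1 / (N : ℝ) = ((N + 1 : ℕ) : ℝ) / N by push_cast; field_simp,
    div_rpow (by positivity) hN'.le, le_div_iff₀ h1] at hb
  rw [succ, mul_comm (negBinom β N), ← mul_assoc]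
  refine mul_le_mul_of_nonneg_right ?_ (nonneg (by linarith) N)
  rw [rpow_sub hN', rpow_sub (by positivity), rpow_one, rpow_one, div_mul_div_comm,
    div_le_div_iff₀ (by positivity) h1]
  have h3 : (β + N) * (N : ℝ) ^ β ≤ N * ((N + 1 : ℕ) : ℝ) ^ β := by
    calc (β + N) * (N : ℝ) ^ β = N * ((1 + β * (1 / N)) * (N : ℝ) ^ β) := by
          field_simp
          ring
      _ ≤ _ := by gcongr
  push_cast at h3 ⊢
  nlinarith

theorem rpow_mul_le {β : ℝ} (hβ : 1 ≤ β) {M N : ℕ} (hM : 0 < M) (hMN : M ≤ N) :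
    (N : ℝ) ^ (1 - β) * negBinom β N ≤ (M : ℝ) ^ (1 - β) * negBinom β M := by
  induction N, hMN using Nat.le_induction with
  | base => exact le_rfl
  | succ N hN ih => exact (rpow_mul_succ_le hβ (hM.trans_le hN)).trans ih

theorem pow_mul_rpow_mul {ρ c q : ℝ} {N : ℕ} (hN : 0 < N) (k : ℕ) :
    q ^ k * ((N : ℝ) ^ (1 - (ρ * k + c)) * negBinom (ρ * k + c) N) =
      (N : ℝ) ^ (1 - c) * ((q / (N : ℝ) ^ ρ) ^ k * negBinom (ρ * k + c) N) := by
  have hN' : (0 : ℝ) < N := by exact_mod_cast hN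
  rw [show 1 - (ρ * k + c) = (1 - c) - ρ * k by ring, rpow_sub hN', rpow_mul hN'.le,
    rpow_natCast, div_pow]
  ring

theorem exists_lt_rpow {ρ : ℝ} (hρ : 0 < ρ) (q : ℝ) : ∃ M : ℕ, 0 < M ∧ q < (M : ℝ) ^ ρ :=
  ((eventually_gt_atTop 0).and
    (((tendsto_rpow_atTop hρ).comp tendsto_natCast_atTop_atTop).eventually_gt_atTop q)).exists

theorem summable_pow_mul_rpow_mul {ρ c q : ℝ} (hρ : 0 ≤ ρ) (hc : 0 ≤ c) (hq : 0 < q) {M : ℕ}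
    (hM : 0 < M) (hqM : q < (M : ℝ) ^ ρ) :
    Summable fun k : ℕ => q ^ k * ((M : ℝ) ^ (1 - (ρ * k + c)) * negBinom (ρ * k + c) M) := by
  simp only [pow_mul_rpow_mul hM]
  have : (0 : ℝ) < (M : ℝ) ^ ρ := hq.trans hqM
  exact (summable_pow_mul hρ hc (div_pos hq this) ((div_lt_one this).2 hqM) M).mul_left _

theorem inv_Gamma_le {β : ℝ} (hβ : 1 ≤ β) {M : ℕ} (hM : 0 < M) :
    (Gamma β)⁻¹ ≤ (M : ℝ) ^ (1 - β) * negBinom β M :=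
  le_of_tendsto (tendsto_rpow_mul (by linarith))
    ((eventually_ge_atTop M).mono fun _ hN => rpow_mul_le hβ hM hN)

theorem tendsto_geomSum {ρ c q : ℝ} (hρ : 1 ≤ ρ) (hc : 0 < c) (hq : 0 < q) :
    Tendsto (fun N : ℕ => (N : ℝ) ^ (1 - c) * geomSum ρ c (q / (N : ℝ) ^ ρ) N) atTop
      (𝓝 (mittagLeffler ρ c q)) := by
  obtain ⟨M, hM, hqM⟩ := exists_lt_rpow (by linarith : 0 < ρ) q
  have hlim : ∀ k : ℕ, Tendsto
      (fun N : ℕ => q ^ k * ((N : ℝ) ^ (1 - (ρ * k + c)) * negBinom (ρ * k + c) N)) atTop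
      (𝓝 (q ^ k / Gamma (ρ * k + c))) := fun k => by
    rw [div_eq_mul_inv]
    exact (tendsto_rpow_mul (by positivity)).const_mul _
  have hbound : Summable fun k : ℕ =>
      q ^ k * ((M : ℝ) ^ (1 - (ρ * k + c)) * negBinom (ρ * k + c) M) +
        if k = 0 then (Gamma c)⁻¹ + 1 else 0 :=
    (summable_pow_mul_rpow_mul (by linarith) hc.le hq hM hqM).add
      (summable_of_ne_finset_zero (s := {0}) fun k hk => if_neg (by simpa using hk))
  have h := tendsto_tsum_of_dominated_convergence hbound hlim ?_
  · refine h.congr' ?_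
    filter_upwards [eventually_gt_atTop 0] with N hN
    rw [geomSum, ← tsum_mul_left]
    exact tsum_congr fun k => pow_mul_rpow_mul hN k
  · have h0 := (tendsto_rpow_mul hc).eventually_le_const (lt_add_one (Gamma c)⁻¹)
    filter_upwards [eventually_ge_atTop M, h0] with N hN h0 k
    have hnn : ∀ L : ℕ, 0 ≤ q ^ k * ((L : ℝ) ^ (1 - (ρ * k + c)) * negBinom (ρ * k + c) L) :=
      fun L => mul_nonneg (by positivity)
        (mul_nonneg (by positivity) (nonneg (by positivity) L))
    rw [norm_of_nonneg (hnn N)]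
    split_ifs with hk
    · subst hk
      have := hnn M
      simp only [pow_zero, one_mul, Nat.cast_zero, mul_zero, zero_add] at this ⊢
      linarith
    · have hk1 : (1 : ℝ) ≤ k := by exact_mod_cast Nat.one_le_iff_ne_zero.2 hk
      rw [add_zero]
      exact mul_le_mul_of_nonneg_left (rpow_mul_le (by nlinarith) hM hN) (by positivity)

end negBinom

theorem summable_mittagLeffler {ρ c q : ℝ} (hρ : 1 ≤ ρ) (hc : 0 < c) (hq : 0 < q) :
    Summable fun k : ℕ => q ^ k / Gamma (ρ * k + c) := by
  obtain ⟨M, hM, hqM⟩ := negBinom.exists_lt_rpow (by linarith : 0 < ρ) q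
  have h := negBinom.summable_pow_mul_rpow_mul (by linarith) hc.le hq hM hqM
  refine (summable_nat_add_iff 1).1 (((summable_nat_add_iff 1).2 h).of_nonneg_of_le
    (fun k => ?_) fun k => ?_)
  · have : 0 < Gamma (ρ * (k + 1 : ℕ) + c) := Gamma_pos_of_pos (by positivity)
    positivity
  · rw [div_eq_mul_inv]
    refine mul_le_mul_of_nonneg_left (negBinom.inv_Gamma_le ?_ hM) (by positivity)
    push_cast
    nlinarith [Nat.cast_nonneg (α := ℝ) k]

theorem contDiff_mittagLeffler {ρ c : ℝ} (hρ : 1 ≤ ρ) (hc : 0 < c) :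
    ContDiff ℝ (⊤ : ℕ∞) (mittagLeffler ρ c) := by
  set p := FormalMultilinearSeries.ofScalars ℝ (fun k : ℕ => (Gamma (ρ * k + c))⁻¹) with hp
  have hrad : p.radius = ⊤ := by
    refine FormalMultilinearSeries.radius_eq_top_of_summable_norm _ fun r => ?_
    have h := summable_mittagLeffler hρ hc (q := r + 1) (by positivity)
    refine h.of_nonneg_of_le (fun k => by positivity) fun k => ?_
    have : 0 < Gamma (ρ * k + c) := Gamma_pos_of_pos (by positivity)
    rw [hp, FormalMultilinearSeries.ofScalars_norm, norm_of_nonneg (by positivity),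
      div_eq_inv_mul]
    gcongr
    linarith
  have hsum : mittagLeffler ρ c = p.sum := by
    ext x
    rw [mittagLeffler, hp, FormalMultilinearSeries.sum]
    refine tsum_congr fun k => ?_
    rw [FormalMultilinearSeries.ofScalars_apply_eq, smul_eq_mul, div_eq_inv_mul]
  have hball : HasFPowerSeriesOnBall p.sum p 0 ⊤ :=
    hrad ▸ p.hasFPowerSeriesOnBall (by simp [hrad])
  rw [hsum]
  have han : AnalyticOnNhd ℝ p.sum univ := fun x _ => hball.analyticAt_of_mem (by simp)
  exact contDiffOn_univ.1 (han.contDiffOn uniqueDiffOn_univ)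

theorem AltDiffNonneg.one_sub_rpow_div {γ L : ℝ} (hγ0 : 0 ≤ γ) (hγ1 : γ ≤ 1) (hL : 0 < L) (n : ℕ)
    {R : ℝ} (hR : ∀ q, 0 < q → q < R → q ^ γ < L) :
    AltDiffNonneg n R (fun q => 1 - q ^ γ / L) := by
  refine of_succ (of_neg_deriv (f' := fun q => -(γ * q ^ (γ - 1) / L)) (fun q h0 h1 => ?_)
    (fun q h0 _ => ?_) ?_)
  · rw [sub_nonneg, div_le_one hL]
    exact (hR q h0 h1).le
  · exact ((Real.hasDerivAt_rpow_const (Or.inl h0.ne')).div_const L).const_sub 1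
  · refine ((const (div_nonneg hγ0 hL.le) n R).mul
      (rpow_neg (sub_nonneg.2 hγ1) n R)).congr fun q _ _ => ?_
    rw [neg_sub]
    ring

theorem tendsto_ladderPotential {ρ q : ℝ} (hρ : 1 < ρ) (hq : 0 < q) :
    Tendsto (fun N : ℕ => (N : ℝ) ^ (2 - ρ) * ladderPotential ρ N (1 - q ^ (1 / ρ) / N)) atTop
      (𝓝 (mittagLeffler ρ (ρ - 1) q - q ^ (1 / ρ) * mittagLeffler ρ ρ q)) := by
  have h1 := negBinom.tendsto_geomSum hρ.le (sub_pos.2 hρ) hq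
  have h2 := negBinom.tendsto_geomSum hρ.le (by linarith : 0 < ρ) hq
  refine (h1.sub (h2.const_mul (q ^ (1 / ρ)))).congr' ?_
  filter_upwards [eventually_gt_atTop 0] with N hN
  have hN' : (0 : ℝ) < N := by exact_mod_cast hN
  have h3 : (q ^ (1 / ρ) / N) ^ ρ = q / (N : ℝ) ^ ρ := by
    rw [div_rpow (by positivity) hN'.le, ← rpow_mul hq.le, one_div_mul_cancel (by linarith),
      rpow_one]
  rw [ladderPotential, sub_sub_cancel, h3, show 1 - (ρ - 1) = 2 - ρ by ring,
    show 2 - ρ = (1 - ρ) + 1 by ring, rpow_add_one hN'.ne']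
  field_simp

theorem AltDiffNonneg.mittagLeffler_combination {ρ : ℝ} (hρ1 : 1 < ρ) (hρ2 : ρ < 2) (n : ℕ)
    (R : ℝ) : AltDiffNonneg n R
      (fun q : ℝ => mittagLeffler ρ (ρ - 1) q - q ^ (1 / ρ) * mittagLeffler ρ ρ q) := by
  refine of_tendsto (F := fun (N : ℕ) q =>
    (N : ℝ) ^ (2 - ρ) * _root_.ladderPotential ρ N (1 - q ^ (1 / ρ) / N)) ?_
    fun q h0 _ => tendsto_ladderPotential hρ1 h0
  filter_upwards [eventually_gt_atTop 0,
    tendsto_natCast_atTop_atTop.eventually_gt_atTop (|R| ^ (1 / ρ))] with N hN hR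
  have hN' : (0 : ℝ) < N := by exact_mod_cast hN
  have hγ : 0 ≤ 1 / ρ := by positivity
  have hlt : ∀ q, 0 < q → q < R → q ^ (1 / ρ) < N := fun q h0 h1 =>
    (rpow_le_rpow h0.le (h1.le.trans (le_abs_self R)) hγ).trans_lt hR
  refine (const (by positivity) n R).mul (.ladderPotential hρ1 hρ2
    (one_sub_rpow_div hγ (by rw [div_le_one] <;> linarith) hN' n hlt)
    (fun q h0 h1 => ?_) (fun q h0 _ => ?_) N)
  · rw [sub_pos, div_lt_one hN']
    exact hlt q h0 h1
  · have : 0 < q ^ (1 / ρ) / N := by positivity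
    linarith

/-- Corollary of Section 4.2, complete monotonicity: for `1 < ρ < 2`, the function
`f(q) = E_{ρ,ρ-1}(q) - q^{1/ρ} E_{ρ,ρ}(q)` is completely monotone on `(0,∞)`. -/
theorem mittagLeffler_combination_completely_monotone (ρ : ℝ) (hρ1 : 1 < ρ) (hρ2 : ρ < 2) :
    ContDiffOn ℝ (⊤ : ℕ∞)
      (fun q : ℝ => mittagLeffler ρ (ρ - 1) q - q ^ (1 / ρ) * mittagLeffler ρ ρ q)
      (Ioi 0) ∧
    ∀ (n : ℕ) (q : ℝ), 0 < q →
      0 ≤ (-1 : ℝ) ^ n *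
        iteratedDeriv n
          (fun q : ℝ => mittagLeffler ρ (ρ - 1) q - q ^ (1 / ρ) * mittagLeffler ρ ρ q) q := by
  have hs : ContDiffOn ℝ (⊤ : ℕ∞)
      (fun q : ℝ => mittagLeffler ρ (ρ - 1) q - q ^ (1 / ρ) * mittagLeffler ρ ρ q) (Ioi 0) :=
    (contDiff_mittagLeffler hρ1.le (sub_pos.2 hρ1)).contDiffOn.sub
      (ContDiffOn.mul
        (fun q hq => (contDiffAt_rpow_const_of_ne (ne_of_gt hq)).contDiffWithinAt)
        (contDiff_mittagLeffler hρ1.le (by linarith)).contDiffOn)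
  exact ⟨hs, fun n q hq =>
    AltDiffNonneg.iteratedDeriv_nonneg (AltDiffNonneg.mittagLeffler_combination hρ1 hρ2) hs n hq⟩
end
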